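/- Let λ₁, …, λ_r ∈ 𝕂 satisfy exp_C(λ_i) ∈ k̄ for each i = 1, …, r. If λ₁, …, λ_r are linearly independent over k = 𝔽_q(θ) (as elements of the k-vector space 𝕂), then λ₁, …, λ_r are algebraically independent over k̄. [Paper's main Theorem 'AlgIndCarlitzLogs' (Theorem 1.2.5 / 6.4.2): Carlitz logarithms of algebraic quantities that are linearly independent over the rational function field are algebraically independent.] -/

import Mathlib

open Filter

/-- The subfield `k = 𝔽_q(θ)` of `𝕂` (here `𝔽_q ⊆ 𝕂` is the set of roots of `x^q = x`). -/
def kk (q : ℕ) (𝕂 : Type) [Field 𝕂] (θ : 𝕂) : Subfield 𝕂 :=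
  Subfield.closure ({θ} ∪ {c : 𝕂 | c ^ q = c})

/-- The subfield `k̄ ⊆ 𝕂` of elements algebraic over `k = 𝔽_q(θ)`. -/
def kbarSub (q : ℕ) (𝕂 : Type) [Field 𝕂] (θ : 𝕂) : Subfield 𝕂 :=
  Subfield.closure {x : 𝕂 | IsAlgebraic (kk q 𝕂 θ) x}

/-- Partial sums of the Carlitz exponential `exp_C(z) = Σ z^{q^i}/D_i`,
where `D_i = (θ^{q^i}-θ)(θ^{q^i}-θ^q)⋯(θ^{q^i}-θ^{q^{i-1}})`. -/
noncomputable def expCPartial (q : ℕ) (𝕂 : Type) [Field 𝕂] (θ z : 𝕂) (N : ℕ) : 𝕂 :=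
  ∑ i ∈ Finset.range N,
    z ^ q ^ i * (∏ j ∈ Finset.range i, (θ ^ q ^ i - θ ^ q ^ j))⁻¹

namespace CarlitzLog

section Analytic

open PowerSeries
open scoped NNReal

variable {K : Type*} [NormedField K] [IsUltrametricDist K]

/-- The ring of power series whose coefficients `f_n` satisfy `‖f_n‖ = O(R⁻ⁿ)`. -/
def tate (K : Type*) [NormedField K] [IsUltrametricDist K] (R : ℝ≥0) : Subring K⟦X⟧ where
  carrier := {f | ∃ C : ℝ, ∀ n, ‖coeff n f‖ * (R : ℝ) ^ n ≤ C}
  zero_mem' := ⟨0, fun n => by simp⟩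
  one_mem' := ⟨1, fun n => by
    rw [coeff_one]
    split_ifs with h
    · simp [h]
    · simp⟩
  add_mem' := by
    rintro f g ⟨C, hC⟩ ⟨D, hD⟩
    refine ⟨max C D, fun n => ?_⟩
    rw [map_add]
    have h : (0 : ℝ) ≤ (R : ℝ) ^ n := by positivity
    calc ‖coeff n f + coeff n g‖ * (R : ℝ) ^ n
        ≤ max ‖coeff n f‖ ‖coeff n g‖ * (R : ℝ) ^ n :=
          mul_le_mul_of_nonneg_right (IsUltrametricDist.norm_add_le_max _ _) h
      _ = max (‖coeff n f‖ * (R : ℝ) ^ n) (‖coeff n g‖ * (R : ℝ) ^ n) :=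
          max_mul_of_nonneg _ _ h
      _ ≤ max C D := max_le_max (hC n) (hD n)
  neg_mem' := by
    rintro f ⟨C, hC⟩
    exact ⟨C, fun n => by simpa using hC n⟩
  mul_mem' := by
    rintro f g ⟨C, hC⟩ ⟨D, hD⟩
    have hC0 : 0 ≤ C := le_trans (by positivity) (hC 0)
    have hD0 : 0 ≤ D := le_trans (by positivity) (hD 0)
    refine ⟨C * D, fun n => ?_⟩
    rw [coeff_mul]
    obtain ⟨i, hi, hle⟩ := IsUltrametricDist.exists_norm_finsetSum_le_of_nonempty
      (t := Finset.HasAntidiagonal.antidiagonal n) ⟨(0, n), by simp⟩ (fun i => coeff i.1 f * coeff i.2 g)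
    rw [Finset.HasAntidiagonal.mem_antidiagonal] at hi
    calc _ ≤ ‖coeff i.1 f * coeff i.2 g‖ * (R : ℝ) ^ n := by gcongr
      _ = (‖coeff i.1 f‖ * (R : ℝ) ^ i.1) * (‖coeff i.2 g‖ * (R : ℝ) ^ i.2) := by
          rw [norm_mul, ← hi, pow_add]; ring
      _ ≤ C * D := mul_le_mul (hC _) (hD _) (by positivity) hC0

theorem polynomial_mem_tate (R : ℝ≥0) (p : Polynomial K) : (p : K⟦X⟧) ∈ tate K R := by
  refine ⟨∑ i ∈ p.support, ‖p.coeff i‖ * (R : ℝ) ^ i, fun n => ?_⟩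
  rw [Polynomial.coeff_coe]
  by_cases hn : n ∈ p.support
  · exact Finset.single_le_sum (f := fun i => ‖p.coeff i‖ * (R : ℝ) ^ i)
      (fun i _ => by positivity) hn
  · rw [Polynomial.notMem_support_iff] at hn
    simp only [hn, norm_zero, zero_mul]
    positivity

/-- The value at `x` of a power series. -/
noncomputable def ev (x : K) (f : K⟦X⟧) : K := ∑' n, coeff n f * x ^ n

theorem summable_norm_ev {R : ℝ≥0} {f : K⟦X⟧} (hf : f ∈ tate K R) {x : K} (hx : ‖x‖ < R) :
    Summable fun n => ‖coeff n f * x ^ n‖ := by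
  obtain ⟨C, hC⟩ := hf
  have hR : (0 : ℝ) < R := (norm_nonneg x).trans_lt hx
  refine Summable.of_nonneg_of_le (fun _ => norm_nonneg _) (fun n => ?_)
    ((summable_geometric_of_lt_one (r := ‖x‖ / R) (by positivity)
      ((div_lt_one hR).2 hx)).mul_left C)
  rw [norm_mul, norm_pow, div_pow]
  calc ‖coeff n f‖ * ‖x‖ ^ n = (‖coeff n f‖ * (R : ℝ) ^ n) * (‖x‖ ^ n / (R : ℝ) ^ n) := by
        field_simp
    _ ≤ C * (‖x‖ ^ n / (R : ℝ) ^ n) := by gcongr; exact hC n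

theorem norm_sub_le_max' (x y : K) : ‖x - y‖ ≤ max ‖x‖ ‖y‖ := by
  rw [sub_eq_add_neg, ← norm_neg y]
  exact IsUltrametricDist.norm_add_le_max _ _

variable [CompleteSpace K]

theorem hasSum_ev {R : ℝ≥0} {f : K⟦X⟧} (hf : f ∈ tate K R) {x : K} (hx : ‖x‖ < R) :
    HasSum (fun n => coeff n f * x ^ n) (ev x f) :=
  (summable_norm_ev hf hx).of_norm.hasSum

theorem ev_add {R : ℝ≥0} {f g : K⟦X⟧} (hf : f ∈ tate K R) (hg : g ∈ tate K R) {x : K}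
    (hx : ‖x‖ < R) : ev x (f + g) = ev x f + ev x g := by
  rw [ev, ← ((hasSum_ev hf hx).add (hasSum_ev hg hx)).tsum_eq]
  exact tsum_congr fun n => by rw [map_add, add_mul]

theorem ev_mul {R : ℝ≥0} {f g : K⟦X⟧} (hf : f ∈ tate K R) (hg : g ∈ tate K R) {x : K}
    (hx : ‖x‖ < R) : ev x (f * g) = ev x f * ev x g := by
  rw [ev, ev, ev, tsum_mul_tsum_eq_tsum_sum_antidiagonal_of_summable_norm
    (summable_norm_ev hf hx) (summable_norm_ev hg hx)]
  refine tsum_congr fun n => ?_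
  rw [coeff_mul, Finset.sum_mul]
  refine Finset.sum_congr rfl fun i hi => ?_
  rw [← Finset.HasAntidiagonal.mem_antidiagonal.1 hi, pow_add]
  ring

omit [IsUltrametricDist K] [CompleteSpace K] in
theorem ev_polynomial (x : K) (p : Polynomial K) : ev x (p : K⟦X⟧) = p.eval x := by
  rw [ev, Polynomial.eval_eq_sum_range, tsum_eq_sum (s := Finset.range (p.natDegree + 1))]
  · simp
  · intro n hn
    rw [Polynomial.coeff_coe, Polynomial.coeff_eq_zero_of_natDegree_lt, zero_mul]
    simpa using hn

theorem ev_sum {ι : Type*} {R : ℝ≥0} (s : Finset ι) {f : ι → K⟦X⟧}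
    (hf : ∀ i ∈ s, f i ∈ tate K R) {x : K} (hx : ‖x‖ < R) :
    ev x (∑ i ∈ s, f i) = ∑ i ∈ s, ev x (f i) := by
  classical
  induction s using Finset.induction_on with
  | empty => simp [ev]
  | insert a s ha ih =>
    rw [Finset.sum_insert ha, Finset.sum_insert ha, ev_add (hf a (Finset.mem_insert_self a s))
      (sum_mem fun i hi => hf i (Finset.mem_insert_of_mem hi)) hx,
      ih fun i hi => hf i (Finset.mem_insert_of_mem hi)]

theorem ev_prod_pow {ι : Type*} {R : ℝ≥0} (s : Finset ι) {f : ι → K⟦X⟧} (e : ι → ℕ)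
    (hf : ∀ i ∈ s, f i ∈ tate K R) {x : K} (hx : ‖x‖ < R) :
    ev x (∏ i ∈ s, f i ^ e i) = ∏ i ∈ s, ev x (f i) ^ e i := by
  classical
  have hone : ev x (1 : K⟦X⟧) = 1 := by
    simpa using ev_polynomial x (1 : Polynomial K)
  have hpow : ∀ g ∈ tate K R, ∀ n : ℕ, ev x (g ^ n) = ev x g ^ n := by
    intro g hg n
    induction n with
    | zero => simpa using hone
    | succ n ih => rw [pow_succ, ev_mul (pow_mem hg n) hg hx, ih, pow_succ]
  induction s using Finset.induction_on with
  | empty => simpa using hone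
  | insert a s ha ih =>
    have h1 := hf a (Finset.mem_insert_self a s)
    have h2 : ∀ i ∈ s, f i ∈ tate K R := fun i hi => hf i (Finset.mem_insert_of_mem hi)
    rw [Finset.prod_insert ha, Finset.prod_insert ha, ev_mul (pow_mem h1 _)
      (prod_mem fun i hi => pow_mem (h2 i hi) _) hx, ih h2, hpow _ h1]

/-- A power series vanishing at `x` is divisible by `X - x`, with control of the quotient. -/
theorem exists_factor {R : ℝ≥0} {f : K⟦X⟧} {C : ℝ} (hC : ∀ n, ‖coeff n f‖ * (R : ℝ) ^ n ≤ C)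
    {x : K} (hx : ‖x‖ < R) (h0 : ev x f = 0) :
    ∃ g : K⟦X⟧, f = (X - PowerSeries.C x) * g ∧
      ∀ n, ‖coeff n g‖ * (R : ℝ) ^ n ≤ C / R := by
  have hf : f ∈ tate K R := ⟨C, hC⟩
  have hR : (0 : ℝ) < R := (norm_nonneg x).trans_lt hx
  have hC0 : 0 ≤ C := le_trans (by positivity) (hC 0)
  have hs : ∀ m, Summable fun k => coeff (m + k) f * x ^ k := by
    intro m
    by_cases hx0 : x = 0
    · refine summable_of_ne_finset_zero (s := {0}) fun k hk => ?_
      rw [hx0, zero_pow (by simpa using hk), mul_zero]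
    · have := ((summable_nat_add_iff m).2 (hasSum_ev hf hx).summable).mul_left (x ^ m)⁻¹
      refine this.congr fun k => ?_
      rw [pow_add, add_comm k m]
      field_simp
  have hshift : ∀ m, ∑' k, coeff (m + k) f * x ^ k =
      coeff m f + x * ∑' k, coeff (m + 1 + k) f * x ^ k := by
    intro m
    rw [(hs m).tsum_eq_zero_add, ← tsum_mul_left]
    congr 1
    · simp
    · refine tsum_congr fun k => ?_
      rw [show m + (k + 1) = m + 1 + k by ring]
      ring
  refine ⟨PowerSeries.mk fun n => ∑' k, coeff (n + 1 + k) f * x ^ k, ?_, fun n => ?_⟩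
  · ext n
    rw [sub_mul, map_sub, coeff_C_mul, coeff_mk]
    cases n with
    | zero =>
      have h := hshift 0
      rw [show ∑' k, coeff (0 + k) f * x ^ k = 0 by simpa [ev] using h0] at h
      rw [coeff_zero_X_mul, zero_sub, eq_neg_iff_add_eq_zero]
      exact h.symm
    | succ n =>
      rw [coeff_succ_X_mul, coeff_mk, hshift (n + 1)]
      ring
  · rw [coeff_mk]
    have : ‖∑' k, coeff (n + 1 + k) f * x ^ k‖ ≤ C / (R : ℝ) ^ (n + 1) := by
      refine IsUltrametricDist.norm_tsum_le_of_forall_le_of_nonneg (by positivity) fun k => ?_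
      rw [norm_mul, norm_pow, le_div_iff₀ (by positivity)]
      calc ‖coeff (n + 1 + k) f‖ * ‖x‖ ^ k * (R : ℝ) ^ (n + 1)
          ≤ ‖coeff (n + 1 + k) f‖ * (R : ℝ) ^ k * (R : ℝ) ^ (n + 1) := by gcongr
        _ = ‖coeff (n + 1 + k) f‖ * (R : ℝ) ^ (n + 1 + k) := by rw [pow_add _ (n + 1) k]; ring
        _ ≤ C := hC _
    calc _ ≤ C / (R : ℝ) ^ (n + 1) * (R : ℝ) ^ n := by gcongr
      _ = C / R := by rw [pow_succ]; field_simp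

/-- A Schwarz lemma: a power series with many zeros in a smaller disc has small coefficients. -/
theorem norm_coeff_le_of_zeros {R : ℝ≥0} (hR : 1 ≤ R) (s : Finset K) (f : K⟦X⟧) {C : ℝ}
    (hC : ∀ n, ‖coeff n f‖ * (R : ℝ) ^ n ≤ C) (hs : ∀ x ∈ s, ‖x‖ < R)
    (h0 : ∀ x ∈ s, ev x f = 0) (n : ℕ) :
    ‖coeff n f‖ ≤ (∏ x ∈ s, max 1 ‖x‖) * (C / (R : ℝ) ^ s.card) := by
  classical
  induction s using Finset.induction_on generalizing f C n with
  | empty =>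
    simp only [Finset.prod_empty, Finset.card_empty, pow_zero, div_one, one_mul]
    exact le_trans (le_mul_of_one_le_right (norm_nonneg _) (one_le_pow₀ (by exact_mod_cast hR)))
      (hC n)
  | insert a s ha ih =>
    have haR : ‖a‖ < R := hs a (Finset.mem_insert_self a s)
    obtain ⟨g, hfg, hg⟩ := exists_factor hC haR (h0 a (Finset.mem_insert_self a s))
    have hgt : g ∈ tate K R := ⟨_, hg⟩
    have hzero : ∀ x ∈ s, ev x g = 0 := by
      intro x hx
      have h1 := h0 x (Finset.mem_insert_of_mem hx)
      have hXC : (X - PowerSeries.C a : K⟦X⟧) = ((Polynomial.X - Polynomial.C a : Polynomial K) :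
          K⟦X⟧) := by simp
      rw [hfg, hXC, ev_mul (polynomial_mem_tate R _) hgt (hs x (Finset.mem_insert_of_mem hx)),
        ev_polynomial, mul_eq_zero] at h1
      refine h1.resolve_left fun h2 => ha ?_
      have : x = a := by simpa [sub_eq_zero] using h2
      exact this ▸ hx
    have hgn := ih g hg (fun x hx => hs x (Finset.mem_insert_of_mem hx)) hzero
    rw [Finset.prod_insert ha, Finset.card_insert_of_notMem ha]
    set B := (∏ x ∈ s, max 1 ‖x‖) * (C / R / (R : ℝ) ^ s.card) with hB
    have hB0 : 0 ≤ B := (norm_nonneg _).trans (hgn 0)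
    have key : ‖coeff n f‖ ≤ max 1 ‖a‖ * B := by
      rw [hfg, sub_mul, map_sub, coeff_C_mul]
      refine (norm_sub_le_max' _ _).trans (max_le ?_ ?_)
      · cases n with
        | zero => rw [coeff_zero_X_mul, norm_zero]; positivity
        | succ n =>
          rw [coeff_succ_X_mul]
          exact (hgn n).trans (le_mul_of_one_le_left hB0 (le_max_left _ _))
      · rw [norm_mul]
        exact mul_le_mul (le_max_right _ _) (hgn n) (norm_nonneg _) (by positivity)
    refine key.trans (le_of_eq ?_)
    rw [hB, pow_succ]
    field_simp

omit [CompleteSpace K] in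
/-- Gauss's lemma for two coefficients of maximal norm, chosen with least index. -/
theorem norm_coeff_mul_of_isMax {f g : K⟦X⟧} {i j : ℕ}
    (hfi : ∀ k, ‖coeff k f‖ ≤ ‖coeff i f‖) (hfi' : ∀ k < i, ‖coeff k f‖ < ‖coeff i f‖)
    (hgj : ∀ k, ‖coeff k g‖ ≤ ‖coeff j g‖) (hgj' : ∀ k < j, ‖coeff k g‖ < ‖coeff j g‖)
    (hf : coeff i f ≠ 0) (hg : coeff j g ≠ 0) :
    ‖coeff (i + j) (f * g)‖ = ‖coeff i f‖ * ‖coeff j g‖ := by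
  classical
  have hf' : 0 < ‖coeff i f‖ := norm_pos_iff.2 hf
  have hg' : 0 < ‖coeff j g‖ := norm_pos_iff.2 hg
  rw [coeff_mul, ← Finset.add_sum_erase _ _ (show (i, j) ∈ Finset.HasAntidiagonal.antidiagonal (i + j) by simp),
    ← norm_mul]
  set S := ∑ x ∈ (Finset.HasAntidiagonal.antidiagonal (i + j)).erase (i, j), coeff x.1 f * coeff x.2 g
  have hS : ‖S‖ < ‖coeff i f * coeff j g‖ := by
    rcases ((Finset.HasAntidiagonal.antidiagonal (i + j)).erase (i, j)).eq_empty_or_nonempty with he | hne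
    · simp only [S, he, Finset.sum_empty, norm_zero, norm_mul]
      positivity
    · obtain ⟨x, hx, hle⟩ := IsUltrametricDist.exists_norm_finsetSum_le_of_nonempty hne
        (fun x => coeff x.1 f * coeff x.2 g)
      refine hle.trans_lt ?_
      rw [Finset.mem_erase, Finset.HasAntidiagonal.mem_antidiagonal] at hx
      rw [norm_mul, norm_mul]
      rcases lt_trichotomy x.1 i with h | h | h
      · exact (mul_le_mul_of_nonneg_left (hgj _) (norm_nonneg _)).trans_lt
          (mul_lt_mul_of_pos_right (hfi' _ h) hg')
      · exact absurd (Prod.ext h (by omega)) hx.1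
      · exact mul_lt_mul' (hfi _) (hgj' _ (by omega)) (norm_nonneg _) hf'
  rw [IsUltrametricDist.norm_add_eq_max_of_norm_ne_norm hS.ne', max_eq_left hS.le]

omit [IsUltrametricDist K] [CompleteSpace K] in
/-- A nonzero sequence tending to zero has a first term of maximal norm. -/
theorem exists_first_max {a : ℕ → K} (ha : Tendsto (fun n => ‖a n‖) atTop (nhds 0))
    (h0 : ∃ n, a n ≠ 0) :
    ∃ i, a i ≠ 0 ∧ (∀ k, ‖a k‖ ≤ ‖a i‖) ∧ ∀ k < i, ‖a k‖ < ‖a i‖ := by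
  classical
  obtain ⟨n, hn⟩ := h0
  have hn' : 0 < ‖a n‖ := norm_pos_iff.2 hn
  obtain ⟨N, hN⟩ := eventually_atTop.1 (ha.eventually (gt_mem_nhds hn'))
  have hmax : ∃ i, ∀ k, ‖a k‖ ≤ ‖a i‖ := by
    obtain ⟨i, hi, hmax⟩ := Finset.exists_max_image (Finset.range (N + n + 1)) (fun k => ‖a k‖)
      ⟨n, by simp⟩
    refine ⟨i, fun k => ?_⟩
    by_cases hk : k < N + n + 1
    · exact hmax k (Finset.mem_range.2 hk)
    · exact (hN k (by omega)).le.trans (hmax n (by simp))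
  refine ⟨Nat.find hmax, ?_, Nat.find_spec hmax, fun k hk => ?_⟩
  · exact norm_pos_iff.1 (hn'.trans_le (Nat.find_spec hmax n))
  · have := Nat.find_min hmax hk
    push Not at this
    obtain ⟨l, hl⟩ := this
    exact hl.trans_le (Nat.find_spec hmax l)

omit [CompleteSpace K] in
theorem tendsto_norm_coeff {R : ℝ≥0} (hR : 1 < R) {f : K⟦X⟧} (hf : f ∈ tate K R) :
    Tendsto (fun n => ‖coeff n f‖) atTop (nhds 0) := by
  simpa using (summable_norm_ev hf (x := 1) (by simpa using hR)).tendsto_atTop_zero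

end Analytic

end CarlitzLog

namespace CarlitzLog

open scoped NNReal

/-- A Frobenius power `φ` on a normed field, with a compatible system of `q`-power roots of an
element of norm `q`. -/
structure CarlitzData (K : Type*) [NormedField K] where
  q : ℕ
  two_le : 2 ≤ q
  φ : K →+* K
  φ_apply : ∀ x, φ x = x ^ q
  th : ℕ → K
  norm_th_zero : ‖th 0‖ = q
  th_pow : ∀ n, th (n + 1) ^ q = th n

namespace CarlitzData

section Basic

variable {K : Type*} [NormedField K] (F : CarlitzData K)

/-- The element `θ`. -/
def θ : K := F.th 0

/-- The radius `q²`. -/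
noncomputable def R : ℝ≥0 := (F.q : ℝ≥0) ^ 2

theorem coe_R : (F.R : ℝ) = (F.q : ℝ) ^ 2 := by simp [R]

theorem two_le_real : (2 : ℝ) ≤ F.q := by exact_mod_cast F.two_le

theorem q_pos : 0 < F.q := by have := F.two_le; omega

theorem q_ne_zero : F.q ≠ 0 := F.q_pos.ne'

theorem one_lt_R : 1 < F.R := by
  have h := F.two_le_real
  rw [← NNReal.coe_lt_coe, coe_R, NNReal.coe_one]
  nlinarith

theorem norm_th_pow (n : ℕ) : ‖F.th n‖ ^ F.q ^ n = F.q := by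
  induction n with
  | zero => simpa using F.norm_th_zero
  | succ n ih => rw [pow_succ', pow_mul, ← norm_pow, F.th_pow, ih]

theorem one_lt_norm_th (n : ℕ) : 1 < ‖F.th n‖ := by
  by_contra! h
  have h1 := F.norm_th_pow n
  have h2 := pow_le_one₀ (n := F.q ^ n) (norm_nonneg (F.th n)) h
  have h3 := F.two_le_real
  linarith

theorem norm_th_succ_lt (n : ℕ) : ‖F.th (n + 1)‖ < ‖F.th n‖ := by
  rw [← F.th_pow n, norm_pow]
  exact lt_self_pow₀ (F.one_lt_norm_th _) F.two_le

theorem norm_th_strictAnti : StrictAnti fun n => ‖F.th n‖ :=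
  strictAnti_nat_of_succ_lt F.norm_th_succ_lt

theorem th_injective : Function.Injective F.th := fun _ _ h =>
  F.norm_th_strictAnti.injective (congrArg norm h)

theorem norm_th_le (n : ℕ) : ‖F.th n‖ ≤ F.q := by
  rw [← F.norm_th_zero]
  exact F.norm_th_strictAnti.antitone (Nat.zero_le n)

theorem norm_th_lt_R (n : ℕ) : ‖F.th n‖ < F.R := by
  rw [coe_R]
  have := F.two_le_real
  have := F.norm_th_le n
  nlinarith

/-- The fixed field of `φ`. -/
def Fq : Subfield K := F.φ.eqLocusField (RingHom.id K)

theorem mem_Fq {x : K} : x ∈ F.Fq ↔ F.φ x = x := Iff.rfl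

theorem norm_Fq {x : K} (hx : x ∈ F.Fq) (h0 : x ≠ 0) : ‖x‖ = 1 := by
  rw [mem_Fq, F.φ_apply] at hx
  have h1 : ‖x‖ ^ F.q = ‖x‖ := by rw [← norm_pow, hx]
  have hpos := norm_pos_iff.2 h0
  rcases lt_trichotomy ‖x‖ 1 with h | h | h
  · exact absurd h1 (pow_lt_self_of_lt_one₀ hpos h F.two_le).ne
  · exact h
  · exact absurd h1 (lt_self_pow₀ h F.two_le).ne'

theorem norm_Fq_le (x : F.Fq) : ‖(x : K)‖ ≤ 1 := by
  by_cases h : (x : K) = 0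
  · simp [h]
  · exact (F.norm_Fq x.2 h).le

/-- Polynomials over `𝔽_q` of degree at most `D q^m` in the `q^m`-th root of `θ`. -/
noncomputable def W (m D : ℕ) : Submodule F.Fq K :=
  (Polynomial.degreeLT F.Fq (D * F.q ^ m + 1)).map (Polynomial.aeval (F.th m)).toLinearMap

theorem mem_W {m D : ℕ} {x : K} : x ∈ F.W m D ↔
    ∃ f : Polynomial F.Fq, f.natDegree ≤ D * F.q ^ m ∧ Polynomial.aeval (F.th m) f = x := by
  simp only [W, Submodule.mem_map, AlgHom.toLinearMap_apply]
  refine exists_congr fun f => and_congr_left fun _ => ?_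
  rw [Polynomial.mem_degreeLT]
  by_cases hf : f = 0
  · simp only [hf, Polynomial.degree_zero, Polynomial.natDegree_zero, zero_le, iff_true]
    exact WithBot.bot_lt_coe (D * F.q ^ m + 1)
  · rw [Polynomial.degree_eq_natDegree hf, Nat.cast_lt, Nat.lt_succ_iff]

theorem W_mono {m D D' : ℕ} (h : D ≤ D') : F.W m D ≤ F.W m D' := by
  intro x hx
  obtain ⟨f, hf, rfl⟩ := F.mem_W.1 hx
  exact F.mem_W.2 ⟨f, hf.trans (Nat.mul_le_mul_right _ h), rfl⟩

theorem W_le_succ (m D : ℕ) : F.W m D ≤ F.W (m + 1) D := by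
  intro x hx
  obtain ⟨f, hf, rfl⟩ := F.mem_W.1 hx
  refine F.mem_W.2 ⟨Polynomial.expand F.Fq F.q f, ?_, ?_⟩
  · rw [Polynomial.natDegree_expand, pow_succ, ← mul_assoc]
    exact Nat.mul_le_mul_right _ hf
  · rw [Polynomial.expand_aeval, F.th_pow]

theorem W_le {m m' D D' : ℕ} (hm : m ≤ m') (hD : D ≤ D') : F.W m D ≤ F.W m' D' := by
  refine (F.W_mono hD).trans ?_
  induction m', hm using Nat.le_induction with
  | base => exact le_rfl
  | succ n _ ih => exact ih.trans (F.W_le_succ n D')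

theorem mul_mem_W {m D D' : ℕ} {x y : K} (hx : x ∈ F.W m D) (hy : y ∈ F.W m D') :
    x * y ∈ F.W m (D + D') := by
  obtain ⟨f, hf, rfl⟩ := F.mem_W.1 hx
  obtain ⟨g, hg, rfl⟩ := F.mem_W.1 hy
  refine F.mem_W.2 ⟨f * g, ?_, map_mul _ _ _⟩
  rw [add_mul]
  exact Polynomial.natDegree_mul_le.trans (add_le_add hf hg)

theorem Fq_mem_W {x : K} (hx : x ∈ F.Fq) (m D : ℕ) : x ∈ F.W m D :=
  F.mem_W.2 ⟨Polynomial.C ⟨x, hx⟩, by simp, by simp; rfl⟩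

theorem one_mem_W (m D : ℕ) : (1 : K) ∈ F.W m D := F.Fq_mem_W (one_mem _) m D

theorem θ_mem_W (m : ℕ) : F.θ ∈ F.W m 1 :=
  F.W_le (Nat.zero_le m) le_rfl (F.mem_W.2 ⟨Polynomial.X, by simp, by simp; rfl⟩)

theorem pow_mem_W {m D : ℕ} {x : K} (hx : x ∈ F.W m D) (n : ℕ) : x ^ n ∈ F.W m (n * D) := by
  induction n with
  | zero => simpa using F.one_mem_W m 0
  | succ n ih =>
    rw [pow_succ, add_mul, one_mul]
    exact F.mul_mem_W ih hx

theorem φ_aeval (f : Polynomial F.Fq) (x : K) :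
    F.φ (Polynomial.aeval x f) = Polynomial.aeval (F.φ x) f := by
  rw [Polynomial.aeval_def, Polynomial.aeval_def, Polynomial.hom_eval₂]
  congr 1
  ext c
  exact c.2

theorem φ_th (n : ℕ) : F.φ (F.th (n + 1)) = F.th n := by rw [F.φ_apply, F.th_pow]

theorem φ_mem_W {m D : ℕ} {x : K} (hx : x ∈ F.W (m + 1) D) : F.φ x ∈ F.W m (F.q * D) := by
  obtain ⟨f, hf, rfl⟩ := F.mem_W.1 hx
  refine F.mem_W.2 ⟨f, hf.trans (le_of_eq ?_), ?_⟩
  · rw [pow_succ]; ring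
  · rw [φ_aeval, φ_th]

instance (m D : ℕ) : Module.Finite F.Fq (F.W m D) := by
  have : Module.Finite F.Fq (Polynomial.degreeLT F.Fq (D * F.q ^ m + 1)) :=
    Module.Finite.equiv (Polynomial.degreeLTEquiv F.Fq _).symm
  unfold W
  infer_instance

end Basic

section Ultra

variable {K : Type*} [NormedField K] [IsUltrametricDist K] (F : CarlitzData K)

theorem norm_aeval {x : K} (hx : 1 < ‖x‖) {f : Polynomial F.Fq} (hf : f ≠ 0) :
    ‖Polynomial.aeval x f‖ = ‖x‖ ^ f.natDegree := by
  have hlead : ‖(f.leadingCoeff : K)‖ = 1 :=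
    F.norm_Fq f.leadingCoeff.2 fun h => hf (Polynomial.leadingCoeff_eq_zero.1 (Subtype.ext h))
  rw [Polynomial.aeval_eq_sum_range, Finset.sum_range_succ, add_comm]
  have hmain : ‖f.coeff f.natDegree • x ^ f.natDegree‖ = ‖x‖ ^ f.natDegree := by
    rw [Subfield.smul_def, smul_eq_mul, norm_mul, norm_pow]
    rw [show f.coeff f.natDegree = f.leadingCoeff from rfl, hlead, one_mul]
  have hlt : ‖∑ i ∈ Finset.range f.natDegree, f.coeff i • x ^ i‖ <
      ‖f.coeff f.natDegree • x ^ f.natDegree‖ := by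
    rw [hmain]
    rcases (Finset.range f.natDegree).eq_empty_or_nonempty with he | hne
    · rw [he, Finset.sum_empty, norm_zero]
      positivity
    · obtain ⟨i, hi, hle⟩ := IsUltrametricDist.exists_norm_finsetSum_le_of_nonempty hne
        (fun i => f.coeff i • x ^ i)
      refine hle.trans_lt ?_
      rw [Subfield.smul_def, smul_eq_mul, norm_mul, norm_pow]
      calc _ ≤ 1 * ‖x‖ ^ i := by gcongr; exact F.norm_Fq_le _
        _ < _ := by rw [one_mul]; exact pow_lt_pow_right₀ hx (Finset.mem_range.1 hi)
  rw [IsUltrametricDist.norm_add_eq_max_of_norm_ne_norm hlt.ne', max_eq_left hlt.le, hmain]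

theorem aeval_injective {x : K} (hx : 1 < ‖x‖) :
    Function.Injective (Polynomial.aeval x : Polynomial F.Fq →ₐ[F.Fq] K) := by
  rw [injective_iff_map_eq_zero]
  intro f h
  by_contra hf
  have := F.norm_aeval hx hf
  rw [h, norm_zero] at this
  exact (pow_pos (zero_lt_one.trans hx) _).ne this

theorem finrank_W (m D : ℕ) : Module.finrank F.Fq (F.W m D) = D * F.q ^ m + 1 := by
  rw [W, ← (Submodule.equivMapOfInjective _ (F.aeval_injective (F.one_lt_norm_th m)) _).finrank_eq,
    (Polynomial.degreeLTEquiv F.Fq _).finrank_eq,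
    Module.finrank_fin_fun]

theorem norm_le_of_mem_W {m D : ℕ} {x : K} (hx : x ∈ F.W m D) : ‖x‖ ≤ (F.q : ℝ) ^ D := by
  obtain ⟨f, hf, rfl⟩ := F.mem_W.1 hx
  by_cases h0 : f = 0
  · rw [h0, map_zero, norm_zero]; positivity
  · rw [F.norm_aeval (F.one_lt_norm_th m) h0]
    refine (pow_le_pow_right₀ (F.one_lt_norm_th m).le hf).trans (le_of_eq ?_)
    rw [mul_comm, pow_mul, F.norm_th_pow]

theorem one_le_norm_of_mem_W {m D : ℕ} {x : K} (hx : x ∈ F.W m D) (h0 : x ≠ 0) : 1 ≤ ‖x‖ := by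
  obtain ⟨f, hf, rfl⟩ := F.mem_W.1 hx
  have hf0 : f ≠ 0 := by rintro rfl; simp at h0
  rw [F.norm_aeval (F.one_lt_norm_th m) hf0]
  exact one_le_pow₀ (F.one_lt_norm_th m).le

end Ultra

end CarlitzData

end CarlitzLog

namespace CarlitzLog

namespace CarlitzData

open Polynomial

section Step

variable {K : Type*} [NormedField K] (F : CarlitzData K)

/-- Polynomials with coefficients in `W m D`. -/
noncomputable def PW (m D : ℕ) : AddSubgroup K[X] where
  carrier := {f | ∀ n, f.coeff n ∈ F.W m D}
  zero_mem' n := by simp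
  add_mem' hf hg n := by rw [coeff_add]; exact add_mem (hf n) (hg n)
  neg_mem' hf n := by rw [coeff_neg]; exact neg_mem (hf n)

theorem PW_le {m m' D D' : ℕ} (hm : m ≤ m') (hD : D ≤ D') : F.PW m D ≤ F.PW m' D' :=
  fun _ hf n => F.W_le hm hD (hf n)

theorem mul_mem_PW {m D D' : ℕ} {f g : K[X]} (hf : f ∈ F.PW m D) (hg : g ∈ F.PW m D') :
    f * g ∈ F.PW m (D + D') := fun n => by
  rw [coeff_mul]
  exact sum_mem fun i _ => F.mul_mem_W (hf _) (hg _)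

theorem map_mem_PW {m D : ℕ} {f : K[X]} (hf : f ∈ F.PW (m + 1) D) :
    f.map F.φ ∈ F.PW m (F.q * D) := fun n => by
  rw [coeff_map]
  exact F.φ_mem_W (hf n)

theorem one_mem_PW (m D : ℕ) : (1 : K[X]) ∈ F.PW m D := fun n => by
  rw [coeff_one]
  split_ifs
  · exact F.one_mem_W m D
  · exact zero_mem _

theorem eval_mem_W {m D e : ℕ} {f : K[X]} (hf : f ∈ F.PW m D) (he : f.natDegree ≤ e) :
    f.eval F.θ ∈ F.W m (D + e) := by
  rw [eval_eq_sum_range]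
  refine sum_mem fun i hi => F.W_mono ?_ (F.mul_mem_W (hf i) (F.pow_mem_W (F.θ_mem_W m) i))
  rw [Finset.mem_range] at hi
  omega

variable {J : Type*} [Fintype J]

/-- The semilinear operator on row vectors attached to a matrix. -/
noncomputable def step (Φ : J → J → K[X]) : (J → K[X]) →ₗ[F.Fq] (J → K[X]) where
  toFun h j := ∑ i, (h i).map F.φ * Φ i j
  map_add' h h' := by
    ext1 j
    simp [Polynomial.map_add, add_mul, Finset.sum_add_distrib]
  map_smul' c h := by
    ext1 j
    simp only [Pi.smul_apply, RingHom.id_apply, Finset.smul_sum]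
    refine Finset.sum_congr rfl fun i _ => ?_
    have : (c • h i).map F.φ = c • (h i).map F.φ := by
      ext n
      simp only [coeff_map, coeff_smul, Subfield.smul_def, smul_eq_mul, map_mul]
      rw [F.mem_Fq.1 c.2]
    rw [this, smul_mul_assoc]

theorem step_apply (Φ : J → J → K[X]) (h : J → K[X]) (j : J) :
    F.step Φ h j = ∑ i, (h i).map F.φ * Φ i j := rfl

theorem step_mem {Φ : J → J → K[X]} {m₀ C : ℕ} (hΦ : ∀ i j, Φ i j ∈ F.PW m₀ C) {m D : ℕ}
    (hm : m₀ ≤ m) {h : J → K[X]} (hh : ∀ j, h j ∈ F.PW (m + 1) D) (j : J) :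
    F.step Φ h j ∈ F.PW m (F.q * D + C) :=
  sum_mem fun i _ => F.mul_mem_PW (F.map_mem_PW (hh i)) (F.PW_le hm le_rfl (hΦ i j))

theorem step_pow_mem {Φ : J → J → K[X]} {m₀ C : ℕ} (hΦ : ∀ i j, Φ i j ∈ F.PW m₀ C) {M H : ℕ}
    {h : J → K[X]} (hh : ∀ j, h j ∈ F.PW M H) {ν : ℕ} (hν : ν + m₀ ≤ M) :
    ∃ D, D + C ≤ F.q ^ ν * (H + C) ∧ ∀ j, (F.step Φ ^ ν) h j ∈ F.PW (M - ν) D := by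
  induction ν with
  | zero => exact ⟨H, by simp, by simpa using hh⟩
  | succ ν ih =>
    obtain ⟨D, hD, hmem⟩ := ih (by omega)
    refine ⟨F.q * D + C, ?_, fun j => ?_⟩
    · calc F.q * D + C + C = F.q * D + 2 * C := by ring
        _ ≤ F.q * D + F.q * C := by have := F.two_le; gcongr
        _ = F.q * (D + C) := by ring
        _ ≤ F.q * (F.q ^ ν * (H + C)) := by gcongr
        _ = _ := by ring
    · rw [pow_succ', Module.End.mul_apply]
      refine F.step_mem hΦ (by omega) (fun j => ?_) j
      rw [show M - (ν + 1) + 1 = M - ν by omega]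
      exact hmem j

theorem natDegree_step_pow_le {Φ : J → J → K[X]} {C : ℕ} (hΦ : ∀ i j, (Φ i j).natDegree ≤ C)
    {N : ℕ} {h : J → K[X]} (hh : ∀ j, (h j).natDegree ≤ N) (ν : ℕ) (j : J) :
    ((F.step Φ ^ ν) h j).natDegree ≤ N + ν * C := by
  induction ν generalizing j with
  | zero => simpa using hh j
  | succ ν ih =>
    rw [pow_succ', Module.End.mul_apply, step_apply]
    refine natDegree_sum_le_of_forall_le _ _ fun i _ => natDegree_mul_le.trans ?_
    rw [natDegree_map, add_mul, one_mul, ← add_assoc]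
    exact add_le_add (ih i) (hΦ i j)

theorem sum_pow_sub_le {q V M : ℕ} (hq : 2 ≤ q) (hV : V ≤ M) :
    ∑ ν ∈ Finset.range V, q ^ (M - ν) + 2 * q ^ (M - V) ≤ 2 * q ^ M := by
  induction V with
  | zero => simp
  | succ V ih =>
    refine le_trans ?_ (ih (by omega))
    rw [Finset.sum_range_succ, add_assoc, show M - V = M - (V + 1) + 1 by omega, pow_succ]
    have : q ^ (M - (V + 1)) * 2 ≤ q ^ (M - (V + 1)) * q := Nat.mul_le_mul_left _ hq
    omega

theorem exists_ne_zero_of_finrank_lt {k U V ι : Type*} [Field k] [AddCommGroup U] [Module k U]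
    [AddCommGroup V] [Module k V] [Fintype ι] (W : ι → Submodule k V)
    [∀ i, Module.Finite k (W i)] [Module.Finite k U] (L : ι → U →ₗ[k] V)
    (hL : ∀ i u, L i u ∈ W i)
    (hlt : ∑ i, Module.finrank k (W i) < Module.finrank k U) :
    ∃ u, u ≠ 0 ∧ ∀ i, L i u = 0 := by
  have h := LinearMap.ker_ne_bot_of_finrank_lt
    (f := LinearMap.pi fun i => (L i).codRestrict (W i) (hL i))
    (by rwa [Module.finrank_pi_fintype])
  obtain ⟨u, hu, hu0⟩ := Submodule.exists_mem_ne_zero_of_ne_bot h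
  refine ⟨u, hu0, fun i => ?_⟩
  have := congrFun (LinearMap.mem_ker.1 hu) i
  exact congrArg Subtype.val this

end Step

section Aux

variable {K : Type*} [NormedField K] [IsUltrametricDist K] (F : CarlitzData K)
variable {J : Type*} [Fintype J]

theorem exists_auxiliary {Φ : J → J → K[X]} {m₀ C : ℕ} (hΦ : ∀ i j, Φ i j ∈ F.PW m₀ C)
    (hΦd : ∀ i j, (Φ i j).natDegree ≤ C) {ρ : J → K} (hρ : ∀ j, ρ j ∈ F.W m₀ C) (j₀ : J)
    {s : ℕ} (hs : 0 < s) :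
    ∃ h : J → K[X], h ≠ 0 ∧
      (∀ j, h j ∈ F.PW (2 * Fintype.card J * s + s + m₀) (4 * Fintype.card J * (C + 1))) ∧
      (∀ j, (h j).natDegree ≤ 2 * Fintype.card J * s) ∧
      ∀ ν < 2 * Fintype.card J * s + s, ∀ j,
        ρ j₀ * ((F.step Φ ^ ν) h j).eval F.θ = ρ j * ((F.step Φ ^ ν) h j₀).eval F.θ := by
  classical
  set ℓ := Fintype.card J with hℓ
  set N := 2 * ℓ * s with hN
  set V := N + s with hV
  set M := V + m₀ with hM
  set H := 4 * ℓ * (C + 1) with hH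
  let P : (J × Fin N → F.W M H) →ₗ[F.Fq] (J → K[X]) :=
    { toFun := fun u j => ∑ n : Fin N, monomial (n : ℕ) ((u (j, n) : F.W M H) : K)
      map_add' := fun u v => by
        ext1 j
        simp [Finset.sum_add_distrib]
      map_smul' := fun c u => by
        ext1 j
        simp only [Pi.smul_apply, Submodule.coe_smul, RingHom.id_apply, Finset.smul_sum,
          smul_monomial] }
  have hPcoeff : ∀ u j n, (P u j).coeff n = if h : n < N then ((u (j, ⟨n, h⟩) : F.W M H) : K)
      else 0 := by
    intro u j n
    simp only [P, LinearMap.coe_mk, AddHom.coe_mk, finsetSum_coeff, coeff_monomial]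
    split_ifs with h
    · rw [Finset.sum_eq_single ⟨n, h⟩] <;> simp
      intro b hb hb'
      exact absurd (Fin.ext hb') hb
    · exact Finset.sum_eq_zero fun b _ => if_neg (by have := b.2; omega)
  have hPmem : ∀ u j, P u j ∈ F.PW M H := by
    intro u j n
    rw [hPcoeff]
    split_ifs
    · exact (u _).2
    · exact zero_mem _
  have hPdeg : ∀ u j, (P u j).natDegree ≤ N := by
    intro u j
    rw [natDegree_le_iff_coeff_eq_zero]
    intro n hn
    rw [hPcoeff, dif_neg (by omega)]
  let evθ : J → (J → K[X]) →ₗ[F.Fq] K := fun j =>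
    ((aeval F.θ : K[X] →ₐ[K] K).toLinearMap.restrictScalars F.Fq).comp (LinearMap.proj j)
  have hevθ : ∀ j h, evθ j h = (h j).eval F.θ := fun j h => by
    simp [evθ, coe_aeval_eq_eval]
  let L : Fin V × {j // j ≠ j₀} → (J × Fin N → F.W M H) →ₗ[F.Fq] K := fun i =>
    (LinearMap.mulLeft F.Fq (ρ j₀)).comp ((evθ i.2).comp ((F.step Φ ^ (i.1 : ℕ)).comp P)) -
    (LinearMap.mulLeft F.Fq (ρ i.2)).comp ((evθ j₀).comp ((F.step Φ ^ (i.1 : ℕ)).comp P))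
  have hLapp : ∀ i u, L i u = ρ j₀ * ((F.step Φ ^ (i.1 : ℕ)) (P u) i.2).eval F.θ -
      ρ i.2 * ((F.step Φ ^ (i.1 : ℕ)) (P u) j₀).eval F.θ := by
    intro i u
    simp [L, hevθ]
  have hL : ∀ i u, L i u ∈ F.W (M - i.1) (F.q ^ (i.1 : ℕ) * (H + 2 * C) + N) := by
    intro i u
    have hi := i.1.2
    obtain ⟨D, hD, hmem⟩ := F.step_pow_mem hΦ (hPmem u) (ν := (i.1 : ℕ)) (by omega)
    have hone : (i.1 : ℕ) * C ≤ F.q ^ (i.1 : ℕ) * C := Nat.mul_le_mul_right _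
      (Nat.lt_pow_self F.two_le).le
    have hterm : ∀ a b, ρ a * ((F.step Φ ^ (i.1 : ℕ)) (P u) b).eval F.θ ∈
        F.W (M - i.1) (F.q ^ (i.1 : ℕ) * (H + 2 * C) + N) := by
      intro a b
      have h1 := F.eval_mem_W (hmem b) (F.natDegree_step_pow_le hΦd (hPdeg u) (i.1 : ℕ) b)
      refine F.W_mono ?_ (F.mul_mem_W (F.W_le (m' := M - i.1) (by omega) le_rfl (hρ a)) h1)
      calc C + (D + (N + i.1 * C)) = (D + C) + (i.1 * C + N) := by ring
        _ ≤ F.q ^ (i.1 : ℕ) * (H + C) + (F.q ^ (i.1 : ℕ) * C + N) := by gcongr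
        _ = _ := by ring
    rw [hLapp]
    exact sub_mem (hterm _ _) (hterm _ _)
  have hcount : ∑ i : Fin V × {j // j ≠ j₀}, Module.finrank F.Fq
      (F.W (M - i.1) (F.q ^ (i.1 : ℕ) * (H + 2 * C) + N)) < Module.finrank F.Fq (J × Fin N → F.W M H) := by
    rw [Module.finrank_pi_fintype, Finset.sum_const, Finset.card_univ, Fintype.card_prod,
      Fintype.card_fin, smul_eq_mul, F.finrank_W, Fintype.sum_prod_type]
    simp only [F.finrank_W, Finset.sum_const, Finset.card_univ, smul_eq_mul]
    rw [Fintype.card_subtype_compl, Fintype.card_subtype_eq, ← Finset.mul_sum, ← hℓ,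
      Fin.sum_univ_eq_sum_range
        (fun ν => (F.q ^ ν * (H + 2 * C) + N) * F.q ^ (M - ν) + 1) V]
    have : Nonempty J := ⟨j₀⟩
    obtain ⟨l, hl⟩ : ∃ l, ℓ = l + 1 :=
      Nat.exists_eq_succ_of_ne_zero (Fintype.card_ne_zero (α := J))
    set Q := F.q ^ M with hQ
    have hsum : ∑ ν ∈ Finset.range V, ((F.q ^ ν * (H + 2 * C) + N) * F.q ^ (M - ν) + 1) ≤
        V * (Q * (H + 2 * C) + 1) + N * (2 * Q) := by
      calc _ = ∑ ν ∈ Finset.range V, ((Q * (H + 2 * C) + 1) + N * F.q ^ (M - ν)) := by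
            refine Finset.sum_congr rfl fun ν hν => ?_
            rw [Finset.mem_range] at hν
            have : Q = F.q ^ ν * F.q ^ (M - ν) := by
              rw [hQ, ← pow_add]; congr 1; omega
            rw [this]; ring
        _ = V * (Q * (H + 2 * C) + 1) + N * ∑ ν ∈ Finset.range V, F.q ^ (M - ν) := by
            rw [Finset.sum_add_distrib, Finset.mul_sum]; simp
        _ ≤ _ := by
            have := sum_pow_sub_le (V := V) (M := M) F.two_le (by omega)
            gcongr
            omega
    refine (Nat.mul_le_mul_left _ hsum).trans_lt ?_
    rw [hl, Nat.add_sub_cancel]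
    have key : (l + 1) * N * (H * Q + 1) = l * (V * (Q * (H + 2 * C) + 1) + N * (2 * Q)) +
        (C * Q * s * (6 * l + 8) + Q * s * (8 * l + 8) + s * (l + 2)) := by
      rw [hV, hN, hH, hl]; ring
    rw [key]
    have : 0 < s * (l + 2) := by positivity
    omega
  obtain ⟨u, hu0, hu⟩ := exists_ne_zero_of_finrank_lt _ L hL hcount
  refine ⟨P u, fun h => hu0 ?_, hPmem u, hPdeg u, fun ν hν j => ?_⟩
  · ext x
    have := hPcoeff u x.1 x.2
    rw [h, dif_pos x.2.2] at this
    exact this.symm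
  · by_cases hj : j = j₀
    · rw [hj]
    · have := hu (⟨ν, hν⟩, ⟨j, hj⟩)
      rw [hLapp, sub_eq_zero] at this
      exact this

end Aux

end CarlitzData

end CarlitzLog

namespace CarlitzLog

/-- The growth of the coefficients in `exists_elimination`. -/
def elimBound : ℕ → ℕ → ℕ
  | 0, _ => 0
  | l + 1, D => elimBound l (2 * D) + D

/-- Any `l + 1` row vectors of length `l` over a filtered domain satisfy a linear relation with
controlled coefficients. -/
theorem exists_elimination {A : Type*} [CommRing A] [IsDomain A] (S : ℕ → AddSubgroup A)
    (hone : 1 ∈ S 0) (hmul : ∀ {a b x y}, x ∈ S a → y ∈ S b → x * y ∈ S (a + b))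
    (hmono : Monotone S) (l D : ℕ) (v : Fin (l + 1) → Fin l → A) (hv : ∀ n j, v n j ∈ S D) :
    ∃ c : Fin (l + 1) → A, c ≠ 0 ∧ (∀ n, c n ∈ S (elimBound l D)) ∧
      ∀ j, ∑ n, c n * v n j = 0 := by
  induction l generalizing D with
  | zero =>
    refine ⟨fun _ => 1, fun h => ?_, fun _ => hone, fun j => j.elim0⟩
    exact one_ne_zero (congrFun h 0)
  | succ l ih =>
    by_cases hpiv : ∃ k, v k 0 ≠ 0
    · obtain ⟨k, hk⟩ := hpiv
      obtain ⟨c, hc0, hcS, hc⟩ := ih (2 * D)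
        (fun n j => v k 0 * v (k.succAbove n) j.succ - v (k.succAbove n) 0 * v k j.succ)
        (fun n j => by
          rw [two_mul]
          exact sub_mem (hmul (hv _ _) (hv _ _)) (hmul (hv _ _) (hv _ _)))
      refine ⟨k.insertNth (-∑ n, c n * v (k.succAbove n) 0) (fun n => c n * v k 0), ?_, ?_, ?_⟩
      · obtain ⟨n, hn⟩ := Function.ne_iff.1 hc0
        refine Function.ne_iff.2 ⟨k.succAbove n, ?_⟩
        rw [Fin.insertNth_apply_succAbove]
        exact mul_ne_zero hn hk
      · intro n
        refine Fin.succAboveCases k ?_ (fun n => ?_) n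
        · rw [Fin.insertNth_apply_same]
          exact neg_mem (sum_mem fun n _ => hmul (hcS n) (hv _ _))
        · rw [Fin.insertNth_apply_succAbove]
          exact hmul (hcS n) (hv _ _)
      · intro j
        rw [Fin.sum_univ_succAbove _ k]
        simp only [Fin.insertNth_apply_same, Fin.insertNth_apply_succAbove]
        refine Fin.cases ?_ (fun j => ?_) j
        · rw [neg_mul, Finset.sum_mul, neg_add_eq_zero]
          exact Finset.sum_congr rfl fun n _ => by ring
        · have := hc j
          rw [← this, neg_mul, Finset.sum_mul, ← Finset.sum_neg_distrib, ← Finset.sum_add_distrib]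
          exact Finset.sum_congr rfl fun n _ => by ring
    · push Not at hpiv
      obtain ⟨c, hc0, hcS, hc⟩ := ih D (fun n j => v n.succ j.succ) (fun n j => hv _ _)
      refine ⟨Fin.cons 0 c, ?_, ?_, ?_⟩
      · obtain ⟨n, hn⟩ := Function.ne_iff.1 hc0
        exact Function.ne_iff.2 ⟨n.succ, by simpa using hn⟩
      · intro n
        refine Fin.cases (by simp) (fun n => ?_) n
        rw [Fin.cons_succ]
        have hle : ∀ l {D D'}, D ≤ D' → elimBound l D ≤ elimBound l D' := by
          intro l
          induction l with
          | zero => intro D D' _; exact le_rfl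
          | succ l ih => intro D D' h; exact add_le_add (ih (by omega)) h
        exact hmono (show elimBound l D ≤ elimBound (l + 1) D from
          (hle l (by omega)).trans (Nat.le_add_right _ _)) (hcS n)
      · intro j
        rw [Fin.sum_univ_succ]
        simp only [Fin.cons_zero, zero_mul, zero_add, Fin.cons_succ]
        refine Fin.cases ?_ (fun j => hc j) j
        simp [hpiv]

namespace CarlitzData

open Polynomial

section Twist

variable {K : Type*} [NormedField K] [IsUltrametricDist K] (F : CarlitzData K)

/-- The Frobenius twist on power series. -/
noncomputable def τ : PowerSeries K →+* PowerSeries K := PowerSeries.map F.φ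

omit [IsUltrametricDist K] in
theorem coeff_τ (n : ℕ) (f : PowerSeries K) :
    PowerSeries.coeff n (F.τ f) = PowerSeries.coeff n f ^ F.q := by
  rw [τ, PowerSeries.coeff_map, F.φ_apply]

omit [IsUltrametricDist K] in
theorem norm_coeff_τ_pow (n ν : ℕ) (f : PowerSeries K) :
    ‖PowerSeries.coeff n ((F.τ ^ ν) f)‖ = ‖PowerSeries.coeff n f‖ ^ F.q ^ ν := by
  induction ν with
  | zero => simp
  | succ ν ih =>
    rw [pow_succ' F.τ, RingHom.mul_def, RingHom.comp_apply, coeff_τ, norm_pow, ih, ← pow_mul,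
      pow_succ]

theorem τ_mem_tate {f : PowerSeries K} (hf : f ∈ tate K F.R) : F.τ f ∈ tate K F.R := by
  obtain ⟨C, hC⟩ := hf
  refine ⟨C ^ F.q, fun n => ?_⟩
  rw [coeff_τ, norm_pow]
  have hR : (1 : ℝ) ≤ (F.R : ℝ) ^ n := one_le_pow₀ (by exact_mod_cast F.one_lt_R.le)
  calc _ ≤ ‖PowerSeries.coeff n f‖ ^ F.q * ((F.R : ℝ) ^ n) ^ F.q := by
        gcongr
        exact le_self_pow₀ hR F.q_ne_zero
    _ = (‖PowerSeries.coeff n f‖ * (F.R : ℝ) ^ n) ^ F.q := by rw [mul_pow]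
    _ ≤ C ^ F.q := by gcongr; exact hC n

omit [IsUltrametricDist K] in
theorem τ_coe (f : K[X]) : F.τ (f : PowerSeries K) = (f.map F.φ : K[X]) := by
  ext n
  simp [τ]

variable [CompleteSpace K]

omit [IsUltrametricDist K] [CompleteSpace K] in
theorem continuous_φ : Continuous F.φ := by
  have : (F.φ : K → K) = fun x => x ^ F.q := funext F.φ_apply
  rw [this]
  fun_prop

omit [IsUltrametricDist K] [CompleteSpace K] in
theorem norm_θ_lt_R : ‖F.θ‖ < F.R := F.norm_th_lt_R 0

theorem φ_ev {f : PowerSeries K} (hf : f ∈ tate K F.R) {x : K} (hx : ‖x‖ < F.R) :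
    F.φ (ev x f) = ev (F.φ x) (F.τ f) := by
  have := (hasSum_ev hf hx).map F.φ F.continuous_φ
  rw [← this.tsum_eq, ev]
  exact tsum_congr fun n => by simp [τ]

theorem φ_pow_ev {f : PowerSeries K} (hf : f ∈ tate K F.R) (ν : ℕ) :
    (F.φ ^ ν) (ev (F.th ν) f) = ev F.θ ((F.τ ^ ν) f) := by
  induction ν generalizing f with
  | zero => rfl
  | succ ν ih =>
    rw [pow_succ, pow_succ, RingHom.mul_def, RingHom.mul_def, RingHom.comp_apply,
      RingHom.comp_apply, F.φ_ev hf (F.norm_th_lt_R _), F.φ_th, ih (F.τ_mem_tate hf)]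

omit [IsUltrametricDist K] [CompleteSpace K] in
theorem prod_norm_th_le (V : ℕ) : ∏ ν ∈ Finset.range V, ‖F.th ν‖ ≤ (F.q : ℝ) ^ 2 := by
  have h : (∏ ν ∈ Finset.range V, ‖F.th ν‖) * ‖F.th V‖ ^ 2 ≤ (F.q : ℝ) ^ 2 := by
    induction V with
    | zero => simp [F.norm_th_zero]
    | succ V ih =>
      refine le_trans ?_ ih
      rw [Finset.prod_range_succ, mul_assoc, sq ‖F.th V‖]
      gcongr
      rw [← F.th_pow V, norm_pow]
      exact pow_le_pow_right₀ (F.one_lt_norm_th _).le F.two_le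
  refine le_trans (le_mul_of_one_le_right (by positivity) ?_) h
  exact one_le_pow₀ (F.one_lt_norm_th _).le

end Twist

section Relation

variable {K : Type*} [NormedField K] [IsUltrametricDist K] (F : CarlitzData K)
variable {J : Type*} [Fintype J]

/-- The linear form in the `ψ j` with coefficients `h j`. -/
noncomputable def form (ψ : J → PowerSeries K) (h : J → K[X]) : PowerSeries K :=
  ∑ j, (h j : PowerSeries K) * ψ j

omit [IsUltrametricDist K] in
theorem τ_form {ψ : J → PowerSeries K} {Φ : J → J → K[X]}
    (hψ : ∀ i, F.τ (ψ i) = ∑ j, (Φ i j : PowerSeries K) * ψ j) (h : J → K[X]) :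
    F.τ (form ψ h) = form ψ (F.step Φ h) := by
  rw [form, form, map_sum]
  simp only [map_mul, hψ, step_apply, τ_coe, Finset.mul_sum]
  rw [Finset.sum_comm]
  refine Finset.sum_congr rfl fun j _ => ?_
  rw [← coeToPowerSeries.ringHom_apply, map_sum, Finset.sum_mul]
  refine Finset.sum_congr rfl fun i _ => ?_
  rw [coeToPowerSeries.ringHom_apply, Polynomial.coe_mul, mul_assoc]

omit [IsUltrametricDist K] in
theorem τ_pow_form {ψ : J → PowerSeries K} {Φ : J → J → K[X]}
    (hψ : ∀ i, F.τ (ψ i) = ∑ j, (Φ i j : PowerSeries K) * ψ j) (h : J → K[X]) (ν : ℕ) :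
    (F.τ ^ ν) (form ψ h) = form ψ ((F.step Φ ^ ν) h) := by
  induction ν with
  | zero => rfl
  | succ ν ih =>
    rw [pow_succ', RingHom.mul_def, RingHom.comp_apply, ih, F.τ_form hψ, pow_succ' (F.step Φ),
      Module.End.mul_apply]

theorem form_mem_tate {R : NNReal} {ψ : J → PowerSeries K} (ht : ∀ j, ψ j ∈ tate K R)
    (h : J → K[X]) : form ψ h ∈ tate K R :=
  sum_mem fun j _ => mul_mem (polynomial_mem_tate R _) (ht j)

theorem norm_coeff_form_le {R : NNReal} (hR : 1 ≤ R) {ψ : J → PowerSeries K} {B : ℝ}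
    (hB : ∀ j n, ‖PowerSeries.coeff n (ψ j)‖ * (R : ℝ) ^ n ≤ B) {h : J → K[X]} {A : ℝ} {N : ℕ}
    (hA : ∀ j n, ‖(h j).coeff n‖ ≤ A) (hN : ∀ j, (h j).natDegree ≤ N) (hA0 : 0 ≤ A) (hB0 : 0 ≤ B)
    (n : ℕ) : ‖PowerSeries.coeff n (form ψ h)‖ * (R : ℝ) ^ n ≤ A * (R : ℝ) ^ N * B := by
  have hR' : (1 : ℝ) ≤ R := by exact_mod_cast hR
  have hRn : (0 : ℝ) < (R : ℝ) ^ n := by positivity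
  rw [← le_div_iff₀ hRn, form, map_sum]
  refine IsUltrametricDist.norm_sum_le_of_forall_le_of_nonneg (by positivity) fun j _ => ?_
  rw [PowerSeries.coeff_mul]
  refine IsUltrametricDist.norm_sum_le_of_forall_le_of_nonneg (by positivity) fun i hi => ?_
  rw [Finset.HasAntidiagonal.mem_antidiagonal] at hi
  rw [le_div_iff₀ hRn, norm_mul, coeff_coe, ← hi, pow_add]
  by_cases hiN : i.1 ≤ N
  · calc _ = ‖(h j).coeff i.1‖ * (R : ℝ) ^ i.1 * (‖PowerSeries.coeff i.2 (ψ j)‖ * (R : ℝ) ^ i.2) := by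
          ring
      _ ≤ A * (R : ℝ) ^ N * B := by
          gcongr
          · exact hA _ _
          · exact hB _ _
  · rw [coeff_eq_zero_of_natDegree_lt ((hN j).trans_lt (not_le.1 hiN))]
    simp only [norm_zero, zero_mul]
    positivity

theorem τ_pow_lower_bound {f : PowerSeries K} (hf : f ∈ tate K F.R) (hf0 : f ≠ 0) {l M D : ℕ}
    {c : Fin l → K[X]} (hc0 : c ≠ 0) (hc : ∀ n, c n ∈ F.PW M D)
    (hrel : ∑ n, (c n : PowerSeries K) * (F.τ ^ (n : ℕ)) f = 0) :
    ∃ i, 1 ≤ (F.q : ℝ) ^ D * ‖PowerSeries.coeff i f‖ := by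
  classical
  obtain ⟨i, hi0, hmax, hmax'⟩ := exists_first_max (tendsto_norm_coeff F.one_lt_R hf)
    (by by_contra! h; exact hf0 (PowerSeries.ext h))
  refine ⟨i, ?_⟩
  set e := ‖PowerSeries.coeff i f‖ with he
  have hepos : 0 < e := norm_pos_iff.2 hi0
  have hqD : (1 : ℝ) ≤ (F.q : ℝ) ^ D := one_le_pow₀ (by linarith [F.two_le_real])
  by_contra! hlt
  have he1 : e < 1 := lt_of_le_of_lt (le_mul_of_one_le_left hepos.le hqD) hlt
  have hex : ∃ n, ∃ h : n < l, c ⟨n, h⟩ ≠ 0 := by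
    obtain ⟨n, hn⟩ := Function.ne_iff.1 hc0
    exact ⟨n, n.2, hn⟩
  obtain ⟨hnl, hcn⟩ := Nat.find_spec hex
  set n₀ := Nat.find hex with hn₀
  have hmin : ∀ n : Fin l, (n : ℕ) < n₀ → c n = 0 := by
    intro n hn
    by_contra h
    exact Nat.find_min hex hn ⟨n.2, h⟩
  set g := c ⟨n₀, hnl⟩ with hg
  obtain ⟨j, hj0, hjmax, hjmax'⟩ := exists_first_max
    (tendsto_norm_coeff F.one_lt_R (polynomial_mem_tate F.R g))
    (by by_contra! h; exact hcn (by ext n; simpa using h n))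
  have hq0 : ∀ n, F.q ^ n ≠ 0 := fun n => pow_ne_zero n F.q_ne_zero
  have hgauss := norm_coeff_mul_of_isMax (f := (g : PowerSeries K)) (g := (F.τ ^ n₀) f) (i := j)
    (j := i) hjmax hjmax'
    (fun k => by
      rw [norm_coeff_τ_pow, norm_coeff_τ_pow]
      exact pow_le_pow_left₀ (norm_nonneg _) (hmax k) _)
    (fun k hk => by
      rw [norm_coeff_τ_pow, norm_coeff_τ_pow]
      exact pow_lt_pow_left₀ (hmax' k hk) (norm_nonneg _) (hq0 _))
    hj0 (by rw [← norm_pos_iff, norm_coeff_τ_pow]; positivity)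
  rw [norm_coeff_τ_pow, ← he] at hgauss
  have hj1 : 1 ≤ ‖PowerSeries.coeff j (g : PowerSeries K)‖ := by
    rw [coeff_coe] at hj0 ⊢
    exact F.one_le_norm_of_mem_W (hc _ j) hj0
  rw [← Finset.add_sum_erase _ _ (Finset.mem_univ (⟨n₀, hnl⟩ : Fin l)), add_eq_zero_iff_eq_neg]
    at hrel
  set y := e ^ F.q ^ n₀ with hy
  have hypos : 0 < y := by positivity
  have hye : y ≤ e := pow_le_of_le_one hepos.le he1.le (hq0 _)
  have hrhs : ‖PowerSeries.coeff (j + i) (-∑ n ∈ Finset.univ.erase (⟨n₀, hnl⟩ : Fin l),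
      (c n : PowerSeries K) * (F.τ ^ (n : ℕ)) f)‖ ≤ (F.q : ℝ) ^ D * y ^ 2 := by
    rw [map_neg, norm_neg, map_sum]
    refine IsUltrametricDist.norm_sum_le_of_forall_le_of_nonneg (by positivity) fun n hn => ?_
    rw [PowerSeries.coeff_mul]
    refine IsUltrametricDist.norm_sum_le_of_forall_le_of_nonneg (by positivity) fun k _ => ?_
    rw [norm_mul, coeff_coe, norm_coeff_τ_pow]
    rcases lt_trichotomy (n : ℕ) n₀ with h | h | h
    · rw [hmin n h, coeff_zero, norm_zero, zero_mul]
      positivity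
    · exact absurd (Fin.ext h) (Finset.ne_of_mem_erase hn)
    · refine mul_le_mul (F.norm_le_of_mem_W (hc n k.1)) ?_ (by positivity) (by positivity)
      calc _ ≤ e ^ F.q ^ (n : ℕ) := pow_le_pow_left₀ (norm_nonneg _) (hmax _) _
        _ ≤ e ^ (F.q ^ n₀ * 2) := by
            refine pow_le_pow_of_le_one hepos.le he1.le ?_
            calc F.q ^ n₀ * 2 ≤ F.q ^ n₀ * F.q := Nat.mul_le_mul_left _ F.two_le
              _ = F.q ^ (n₀ + 1) := (pow_succ _ _).symm
              _ ≤ F.q ^ (n : ℕ) := Nat.pow_le_pow_right F.q_pos h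
        _ = y ^ 2 := pow_mul _ _ _
  rw [← hrel] at hrhs
  rw [show c ⟨n₀, hnl⟩ = g from rfl] at hrhs
  rw [show (F.τ ^ ((⟨n₀, hnl⟩ : Fin l) : ℕ)) f = (F.τ ^ n₀) f from rfl, hgauss] at hrhs
  have h1 : y * 1 ≤ y * ((F.q : ℝ) ^ D * y) := by nlinarith
  have h2 := le_of_mul_le_mul_left h1 hypos
  have h3 : (F.q : ℝ) ^ D * y ≤ (F.q : ℝ) ^ D * e := by gcongr
  linarith

variable [CompleteSpace K]

/-- A linear relation at `θ` between solutions of a Frobenius difference system over the ring of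
polynomials in `q`-power roots of `θ` lifts to a functional relation. -/
theorem exists_relation_of_mem_W {ψ : J → PowerSeries K} (ht : ∀ j, ψ j ∈ tate K F.R)
    {Φ : J → J → K[X]} (hψ : ∀ i, F.τ (ψ i) = ∑ j, (Φ i j : PowerSeries K) * ψ j)
    {m₀ C : ℕ} (hΦ : ∀ i j, Φ i j ∈ F.PW m₀ C)
    (hΦd : ∀ i j, (Φ i j).natDegree ≤ C) {ρ : J → K} (hρ : ∀ j, ρ j ∈ F.W m₀ C) (hρ0 : ρ ≠ 0)
    (hrel : ∑ j, ρ j * ev F.θ (ψ j) = 0) :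
    ∃ M H, ∃ h : J → K[X], h ≠ 0 ∧ (∀ j, h j ∈ F.PW M H) ∧ form ψ h = 0 := by
  classical
  obtain ⟨j₀, hj₀⟩ := Function.ne_iff.1 hρ0
  set ℓ := Fintype.card J with hℓ
  have hℓpos : 0 < ℓ := Fintype.card_pos_iff.2 ⟨j₀⟩
  choose B hB using ht
  have ht : ∀ j, ψ j ∈ tate K F.R := fun j => ⟨B j, hB j⟩
  have hBj : ∀ j, 0 ≤ B j := fun j => le_trans (by positivity) (hB j 0)
  set Bs := ∑ j, B j with hBs
  have hBs0 : 0 ≤ Bs := Finset.sum_nonneg fun j _ => hBj j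
  have hBle : ∀ j n, ‖PowerSeries.coeff n (ψ j)‖ * (F.R : ℝ) ^ n ≤ Bs := fun j n =>
    (hB j n).trans (Finset.single_le_sum (fun j _ => hBj j) (Finset.mem_univ j))
  set H := 4 * ℓ * (C + 1) with hH
  set D := F.q ^ ℓ * (H + C) with hD
  set D' := elimBound ℓ D with hD'
  have hR1 : (1 : ℝ) < F.R := by exact_mod_cast F.one_lt_R
  have hq2 := F.two_le_real
  have hlim : Tendsto (fun s : ℕ => (F.q : ℝ) ^ D' * ((F.q : ℝ) ^ 2 * ((F.q : ℝ) ^ H * Bs *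
      ((F.R : ℝ)⁻¹) ^ s))) atTop (nhds 0) := by
    have := (tendsto_pow_atTop_nhds_zero_of_lt_one (r := (F.R : ℝ)⁻¹) (by positivity)
      (inv_lt_one_of_one_lt₀ hR1)).const_mul ((F.q : ℝ) ^ D' * ((F.q : ℝ) ^ 2 * ((F.q : ℝ) ^ H * Bs)))
    rw [mul_zero] at this
    refine this.congr fun s => by ring
  obtain ⟨s, hs, hs0⟩ := ((hlim.eventually (gt_mem_nhds (zero_lt_one))).and
    (eventually_gt_atTop 0)).exists
  obtain ⟨h, hh0, hhW, hhd, hhv⟩ := F.exists_auxiliary hΦ hΦd hρ j₀ hs0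
  rw [← hℓ, ← hH] at hhW
  rw [← hℓ] at hhd hhv
  set N := 2 * ℓ * s with hN
  set V := N + s with hV
  set M := V + m₀ with hM
  refine ⟨M, H, h, hh0, hhW, ?_⟩
  by_contra hE0
  set E := form ψ h with hE
  have hEt : E ∈ tate K F.R := form_mem_tate ht h
  have hev : ∀ ν < V, ev (F.th ν) E = 0 := by
    intro ν hν
    have h1 : ev F.θ ((F.τ ^ ν) E) = 0 := by
      rw [F.τ_pow_form hψ, form, ev_sum (R := F.R) _ (fun j _ =>
        mul_mem (polynomial_mem_tate F.R _) (ht j)) (F.norm_θ_lt_R)]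
      have : ∀ j, ρ j₀ * ev F.θ (((F.step Φ ^ ν) h j : K[X]) * ψ j) =
          ((F.step Φ ^ ν) h j₀).eval F.θ * (ρ j * ev F.θ (ψ j)) := by
        intro j
        rw [ev_mul (polynomial_mem_tate F.R _) (ht j) (F.norm_θ_lt_R), ev_polynomial,
          ← mul_assoc, hhv ν hν j]
        ring
      have h2 : ρ j₀ * ∑ j, ev F.θ (((F.step Φ ^ ν) h j : K[X]) * ψ j) = 0 := by
        rw [Finset.mul_sum, Finset.sum_congr rfl fun j _ => this j, ← Finset.mul_sum, hrel,
          mul_zero]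
      exact (mul_eq_zero.1 h2).resolve_left hj₀
    rw [← F.φ_pow_ev hEt] at h1
    exact (map_eq_zero _).1 h1
  have hEb := norm_coeff_form_le F.one_lt_R.le hBle
    (fun j n => F.norm_le_of_mem_W (hhW j n)) hhd (by positivity) hBs0
  have hsch := norm_coeff_le_of_zeros F.one_lt_R.le ((Finset.range V).image F.th) E hEb
    (fun x hx => by
      obtain ⟨ν, _, rfl⟩ := Finset.mem_image.1 hx
      exact F.norm_th_lt_R ν)
    (fun x hx => by
      obtain ⟨ν, hν, rfl⟩ := Finset.mem_image.1 hx
      exact hev ν (Finset.mem_range.1 hν))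
  rw [Finset.card_image_of_injective _ F.th_injective, Finset.card_range,
    Finset.prod_image (fun _ _ _ _ h => F.th_injective h)] at hsch
  have hprod : ∏ ν ∈ Finset.range V, max 1 ‖F.th ν‖ ≤ (F.q : ℝ) ^ 2 := by
    rw [Finset.prod_congr rfl fun ν _ => max_eq_right (F.one_lt_norm_th ν).le]
    exact F.prod_norm_th_le V
  have hsmall : ∀ n, (F.q : ℝ) ^ D' * ‖PowerSeries.coeff n E‖ < 1 := by
    intro n
    refine lt_of_le_of_lt ?_ hs
    gcongr
    refine (hsch n).trans ?_
    have : (F.q : ℝ) ^ H * (F.R : ℝ) ^ N * Bs / (F.R : ℝ) ^ V =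
        (F.q : ℝ) ^ H * Bs * ((F.R : ℝ)⁻¹) ^ s := by
      rw [hV, pow_add, inv_pow]
      field_simp
    rw [this]
    gcongr
  have hstepW : ∀ n ≤ ℓ, ∀ j, (F.step Φ ^ n) h j ∈ F.PW M D := by
    intro n hn j
    have hVℓ : ℓ ≤ V := by
      have : ℓ * 1 ≤ ℓ * s := Nat.mul_le_mul_left _ hs0
      have : N = 2 * (ℓ * s) := by rw [hN]; ring
      omega
    obtain ⟨D₁, hD₁, hmem⟩ := F.step_pow_mem hΦ hhW (ν := n) (by omega)
    refine F.PW_le (Nat.sub_le _ _) ?_ (hmem j)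
    calc D₁ ≤ F.q ^ n * (H + C) := by omega
      _ ≤ D := Nat.mul_le_mul_right _ (Nat.pow_le_pow_right F.q_pos hn)
  obtain ⟨c, hc0, hcW, hc⟩ := exists_elimination (fun D => F.PW M D) (F.one_mem_PW M 0)
    (fun hx hy => F.mul_mem_PW hx hy) (fun _ _ h => F.PW_le le_rfl h) ℓ D
    (fun n j => (F.step Φ ^ (n : ℕ)) h ((Fintype.equivFin J).symm j))
    (fun n j => hstepW n (Nat.lt_succ_iff.1 n.2) _)
  have hcrel : ∑ n, (c n : PowerSeries K) * (F.τ ^ (n : ℕ)) E = 0 := by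
    have hτE : ∀ n, (F.τ ^ n) E = form ψ ((F.step Φ ^ n) h) := F.τ_pow_form hψ h
    simp only [hτE, form, Finset.mul_sum]
    rw [Finset.sum_comm]
    refine Finset.sum_eq_zero fun j _ => ?_
    have := congrArg (fun f : K[X] => (f : PowerSeries K) * ψ j) (hc (Fintype.equivFin J j))
    simp only [Equiv.symm_apply_apply, ← coeToPowerSeries.ringHom_apply, map_sum, map_mul,
      Finset.sum_mul, map_zero, zero_mul] at this
    rw [← this]
    exact Finset.sum_congr rfl fun n _ => by simp [mul_assoc]
  obtain ⟨i, hi⟩ := F.τ_pow_lower_bound hEt hE0 hc0 hcW hcrel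
  exact absurd hi (not_le.2 (hsmall i))

end Relation

end CarlitzData

end CarlitzLog

namespace CarlitzLog

namespace CarlitzData

open Polynomial

section Perfect

variable {K : Type*} [NormedField K] (F : CarlitzData K)

/-- The subfield `𝔽_q(θ)`. -/
def k : Subfield K := Subfield.closure ({F.θ} ∪ {c | c ^ F.q = c})

/-- The field generated over `𝔽_q` by all `q`-power roots of `θ`. -/
noncomputable def P : Subfield K where
  carrier := {x | ∃ m D, ∃ a ∈ F.W m D, ∃ b ∈ F.W m D, b ≠ 0 ∧ x * b = a}
  zero_mem' := ⟨0, 0, 0, zero_mem _, 1, F.one_mem_W 0 0, one_ne_zero, by simp⟩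
  one_mem' := ⟨0, 0, 1, F.one_mem_W 0 0, 1, F.one_mem_W 0 0, one_ne_zero, by simp⟩
  neg_mem' := by
    rintro x ⟨m, D, a, ha, b, hb, hb0, h⟩
    exact ⟨m, D, -a, neg_mem ha, b, hb, hb0, by rw [neg_mul, h]⟩
  inv_mem' := by
    rintro x ⟨m, D, a, ha, b, hb, hb0, h⟩
    by_cases hx : x = 0
    · exact ⟨m, D, 0, zero_mem _, b, hb, hb0, by simp [hx]⟩
    · refine ⟨m, D, b, hb, a, ha, ?_, ?_⟩
      · rw [← h]; exact mul_ne_zero hx hb0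
      · rw [← h]; field_simp
  add_mem' := by
    rintro x y ⟨m, D, a, ha, b, hb, hb0, h⟩ ⟨m', D', a', ha', b', hb', hb0', h'⟩
    have hm : m ≤ max m m' := le_max_left _ _
    have hm' : m' ≤ max m m' := le_max_right _ _
    refine ⟨max m m', D + D', a * b' + b * a', add_mem ?_ ?_, b * b', ?_, mul_ne_zero hb0 hb0', ?_⟩
    · exact F.mul_mem_W (F.W_le hm le_rfl ha) (F.W_le hm' le_rfl hb')
    · exact F.mul_mem_W (F.W_le hm le_rfl hb) (F.W_le hm' le_rfl ha')
    · exact F.mul_mem_W (F.W_le hm le_rfl hb) (F.W_le hm' le_rfl hb')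
    · rw [← h, ← h']; ring
  mul_mem' := by
    rintro x y ⟨m, D, a, ha, b, hb, hb0, h⟩ ⟨m', D', a', ha', b', hb', hb0', h'⟩
    have hm : m ≤ max m m' := le_max_left _ _
    have hm' : m' ≤ max m m' := le_max_right _ _
    refine ⟨max m m', D + D', a * a', ?_, b * b', ?_, mul_ne_zero hb0 hb0', ?_⟩
    · exact F.mul_mem_W (F.W_le hm le_rfl ha) (F.W_le hm' le_rfl ha')
    · exact F.mul_mem_W (F.W_le hm le_rfl hb) (F.W_le hm' le_rfl hb')
    · rw [← h, ← h']; ring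

theorem mem_P_of_mem_W {m D : ℕ} {x : K} (hx : x ∈ F.W m D) : x ∈ F.P :=
  ⟨m, D, x, hx, 1, F.one_mem_W m D, one_ne_zero, mul_one x⟩

theorem k_le_P : F.k ≤ F.P := by
  rw [k, Subfield.closure_le]
  rintro x (rfl | hx)
  · exact F.mem_P_of_mem_W (F.θ_mem_W 0)
  · exact F.mem_P_of_mem_W (F.Fq_mem_W (show x ∈ F.Fq from (F.φ_apply x).trans hx) 0 0)

theorem exists_common_denominator (S : Finset K) (hS : ∀ x ∈ S, x ∈ F.P) :
    ∃ m C, ∃ N ∈ F.W m C, N ≠ 0 ∧ ∀ x ∈ S, N * x ∈ F.W m C := by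
  classical
  induction S using Finset.induction_on with
  | empty => exact ⟨0, 0, 1, F.one_mem_W 0 0, one_ne_zero, by simp⟩
  | insert x S hx ih =>
    obtain ⟨m, C, N, hN, hN0, h⟩ := ih fun y hy => hS y (Finset.mem_insert_of_mem hy)
    obtain ⟨m', D, a, ha, b, hb, hb0, hab⟩ := hS x (Finset.mem_insert_self x S)
    have hm : m ≤ max m m' := le_max_left _ _
    have hm' : m' ≤ max m m' := le_max_right _ _
    refine ⟨max m m', C + D, N * b, F.mul_mem_W (F.W_le hm le_rfl hN) (F.W_le hm' le_rfl hb),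
      mul_ne_zero hN0 hb0, fun y hy => ?_⟩
    rcases Finset.mem_insert.1 hy with rfl | hy
    · rw [mul_assoc, mul_comm b, hab]
      exact F.mul_mem_W (F.W_le hm le_rfl hN) (F.W_le hm' le_rfl ha)
    · rw [mul_right_comm]
      exact F.mul_mem_W (F.W_le hm le_rfl (h y hy)) (F.W_le hm' le_rfl hb)

theorem exists_coordinates (S : Set K) (hfin : S.Finite) (hS : ∀ x ∈ S, IsAlgebraic F.k x) :
    ∃ (K₁ : Subfield K) (d : ℕ) (ω : Fin d → K) (rep : K → Fin d → K),
      S ⊆ K₁ ∧ (∀ b, ω b ∈ K₁) ∧ LinearIndependent F.P ω ∧ (∀ x b, rep x b ∈ F.P) ∧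
      ∀ x ∈ K₁, x = ∑ b, rep x b * ω b := by
  classical
  have h_integral : ∀ x ∈ S, IsIntegral F.P x := by
    intro x hx
    let : Algebra F.k F.P := (Subfield.inclusion F.k_le_P).toAlgebra
    have : IsScalarTower F.k F.P K := IsScalarTower.of_algebraMap_eq fun _ => rfl
    exact ((hS x hx).tower_top F.P).isIntegral
  have := hfin.to_subtype
  have : FiniteDimensional F.P (IntermediateField.adjoin F.P S) :=
    IntermediateField.finiteDimensional_adjoin h_integral
  let bas := Module.finBasis F.P (IntermediateField.adjoin F.P S)
  refine ⟨(IntermediateField.adjoin F.P S).toSubfield, _, fun b => (bas b : K),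
    fun x b => if h : x ∈ IntermediateField.adjoin F.P S then (bas.repr ⟨x, h⟩ b : K) else 0,
    IntermediateField.subset_adjoin _ _, fun b => (bas b).2, ?_, ?_, ?_⟩
  · exact bas.linearIndependent.map' (IntermediateField.adjoin F.P S).val.toLinearMap
      (LinearMap.ker_eq_bot.2 Subtype.val_injective)
  · intro x b
    dsimp only
    split_ifs
    · exact (bas.repr _ b).2
    · exact zero_mem _
  · intro x hx
    have hx' : x ∈ IntermediateField.adjoin F.P S := hx
    have := congrArg (IntermediateField.adjoin F.P S).val (bas.sum_repr ⟨x, hx'⟩)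
    rw [map_sum] at this
    simp only [map_smul] at this
    simp only [dif_pos hx']
    exact this.symm

end Perfect

section Relation

variable {K : Type*} [NormedField K] [IsUltrametricDist K] [CompleteSpace K] (F : CarlitzData K)
variable {J : Type*} [Fintype J]

/-- A linear relation over `k̄` at `θ` between solutions of a Frobenius difference system over
`k̄[t]` lifts to a functional relation. -/
theorem exists_relation {ψ : J → PowerSeries K} (ht : ∀ j, ψ j ∈ tate K F.R)
    {Φ : J → J → K[X]} (hψ : ∀ i, F.τ (ψ i) = ∑ j, (Φ i j : PowerSeries K) * ψ j)
    (hΦ : ∀ i j n, IsAlgebraic F.k ((Φ i j).coeff n))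
    {ρ : J → K} (hρ : ∀ j, IsAlgebraic F.k (ρ j)) (hρ0 : ρ ≠ 0)
    (hrel : ∑ j, ρ j * ev F.θ (ψ j) = 0) :
    ∃ h : J → K[X], h ≠ 0 ∧ form ψ h = 0 := by
  classical
  set S : Finset K := (Finset.univ.biUnion fun x : J × J => (Φ x.1 x.2).coeffs) ∪
    Finset.univ.image ρ with hS
  obtain ⟨K₁, d, ω, rep, hSK, hω, hind, hrepP, hrep⟩ := F.exists_coordinates (S : Set K)
    S.finite_toSet (by
      intro x hx
      rw [Finset.mem_coe, hS, Finset.mem_union, Finset.mem_biUnion, Finset.mem_image] at hx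
      rcases hx with ⟨y, _, hy⟩ | ⟨j, _, rfl⟩
      · obtain ⟨n, _, rfl⟩ := Polynomial.mem_coeffs_iff.1 hy
        exact hΦ _ _ _
      · exact hρ j)
  have hΦK : ∀ i j n, (Φ i j).coeff n ∈ K₁ := by
    intro i j n
    by_cases h0 : (Φ i j).coeff n = 0
    · rw [h0]; exact zero_mem _
    · refine hSK ?_
      rw [Finset.mem_coe, hS, Finset.mem_union, Finset.mem_biUnion]
      exact Or.inl ⟨(i, j), Finset.mem_univ _, Polynomial.coeff_mem_coeffs h0⟩
  have hρK : ∀ j, ρ j ∈ K₁ := fun j => hSK (by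
    rw [Finset.mem_coe, hS, Finset.mem_union, Finset.mem_image]
    exact Or.inr ⟨j, Finset.mem_univ _, rfl⟩)
  obtain ⟨e, he⟩ : ∃ e, ∀ i j, (Φ i j).natDegree ≤ e := by
    refine ⟨∑ x : J × J, (Φ x.1 x.2).natDegree, fun i j => ?_⟩
    exact Finset.single_le_sum (f := fun x : J × J => (Φ x.1 x.2).natDegree)
      (fun _ _ => Nat.zero_le _) (Finset.mem_univ (i, j))
  let Φ' : J × Fin d → J × Fin d → K[X] := fun x y =>
    ∑ n ∈ Finset.range (e + 1), monomial n (rep (ω x.2 ^ F.q * (Φ x.1 y.1).coeff n) y.2)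
  have hΦ'c : ∀ x y n, (Φ' x y).coeff n =
      if n < e + 1 then rep (ω x.2 ^ F.q * (Φ x.1 y.1).coeff n) y.2 else 0 := by
    intro x y n
    simp [Φ', finsetSum_coeff, coeff_monomial]
  let ρ' : J × Fin d → K := fun x => rep (ρ x.1) x.2
  have hΦ'sum : ∀ x i, ∑ b, Φ' x (i, b) * C (ω b) = C (ω x.2 ^ F.q) * Φ x.1 i := by
    intro x i
    ext n
    rw [finsetSum_coeff, coeff_C_mul]
    simp only [coeff_mul_C, hΦ'c]
    by_cases hn : n < e + 1
    · simp only [hn, if_true]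
      exact (hrep _ (mul_mem (pow_mem (hω _) _) (hΦK _ _ _))).symm
    · simp only [hn, if_false, zero_mul, Finset.sum_const_zero]
      rw [coeff_eq_zero_of_natDegree_lt (lt_of_le_of_lt (he _ _) (by omega)), mul_zero]
  obtain ⟨m, D, N, hN, hN0, hden⟩ := F.exists_common_denominator
    ((Finset.univ.biUnion fun x : (J × Fin d) × (J × Fin d) => (Φ' x.1 x.2).coeffs) ∪
      Finset.univ.image ρ') (by
      intro x hx
      rw [Finset.mem_union, Finset.mem_biUnion, Finset.mem_image] at hx
      rcases hx with ⟨y, _, hy⟩ | ⟨j, _, rfl⟩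
      · obtain ⟨n, _, rfl⟩ := Polynomial.mem_coeffs_iff.1 hy
        rw [hΦ'c]
        split_ifs
        · exact hrepP _ _
        · exact zero_mem _
      · exact hrepP _ _)
  have hdenΦ : ∀ x y n, N * (Φ' x y).coeff n ∈ F.W m D := by
    intro x y n
    by_cases h0 : (Φ' x y).coeff n = 0
    · rw [h0, mul_zero]; exact zero_mem _
    · refine hden _ ?_
      rw [Finset.mem_union, Finset.mem_biUnion]
      exact Or.inl ⟨(x, y), Finset.mem_univ _, Polynomial.coeff_mem_coeffs h0⟩
  have hdenρ : ∀ x, N * ρ' x ∈ F.W m D := fun x => hden _ (by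
    rw [Finset.mem_union, Finset.mem_image]
    exact Or.inr ⟨x, Finset.mem_univ _, rfl⟩)
  let ψ' : J × Fin d → PowerSeries K := fun x => ((C (N * ω x.2) : K[X]) : PowerSeries K) * ψ x.1
  have hψ't : ∀ x, ψ' x ∈ tate K F.R := fun x => mul_mem (polynomial_mem_tate _ _) (ht _)
  have hq : F.q = F.q - 1 + 1 := by have := F.q_pos; omega
  obtain ⟨M, H, h', hh'0, hh'W, hh'⟩ := F.exists_relation_of_mem_W hψ't
    (Φ := fun x y => C (N ^ (F.q - 1)) * Φ' x y) (ρ := fun x => N * ρ' x)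
    (m₀ := m) (C := F.q * D + D + e) (by
      intro x
      have hterm : ∀ i, ∑ b, ((C (N ^ (F.q - 1)) * Φ' x (i, b) : K[X]) : PowerSeries K) *
          ψ' (i, b) = ((C ((N * ω x.2) ^ F.q) * Φ x.1 i : K[X]) : PowerSeries K) * ψ i := by
        intro i
        have : (C ((N * ω x.2) ^ F.q) * Φ x.1 i : K[X]) =
            ∑ b, C (N ^ (F.q - 1)) * Φ' x (i, b) * C (N * ω b) := by
          rw [mul_pow, C_mul, mul_assoc, ← hΦ'sum, Finset.mul_sum]
          refine Finset.sum_congr rfl fun b _ => ?_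
          conv_lhs => rw [hq, pow_succ]
          rw [C_mul, C_mul]
          ring
        rw [this, ← coeToPowerSeries.ringHom_apply, map_sum, Finset.sum_mul]
        refine Finset.sum_congr rfl fun b _ => ?_
        simp only [ψ', coeToPowerSeries.ringHom_apply, Polynomial.coe_mul, mul_assoc]
      rw [Fintype.sum_prod_type, Finset.sum_congr rfl fun i _ => hterm i]
      simp only [ψ']
      rw [map_mul, hψ, τ_coe, Finset.mul_sum, Polynomial.map_C, F.φ_apply]
      refine Finset.sum_congr rfl fun i _ => ?_
      rw [Polynomial.coe_mul, mul_assoc])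
    (by
      intro x y n
      rw [coeff_C_mul]
      by_cases hq1 : F.q - 1 = 0
      · have := F.two_le; omega
      obtain ⟨r, hr⟩ := Nat.exists_eq_succ_of_ne_zero hq1
      rw [hr, pow_succ, mul_assoc]
      refine F.W_mono ?_ (F.mul_mem_W (F.pow_mem_W hN r) (hdenΦ x y n))
      have : r * D ≤ F.q * D := Nat.mul_le_mul_right _ (by omega)
      omega)
    (by
      intro x y
      refine natDegree_mul_le.trans ?_
      rw [natDegree_C, zero_add]
      have : (Φ' x y).natDegree ≤ e := by
        rw [natDegree_le_iff_coeff_eq_zero]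
        intro n hn
        rw [hΦ'c, if_neg (by omega)]
      omega)
    (fun x => F.W_mono (by omega) (hdenρ x))
    (by
      intro h
      apply hρ0
      ext j
      rw [hrep _ (hρK j), Pi.zero_apply]
      refine Finset.sum_eq_zero fun b _ => ?_
      have := (mul_eq_zero.1 (congrFun h (j, b))).resolve_left hN0
      rw [show rep (ρ j) b = 0 from this, zero_mul])
    (by
      rw [Fintype.sum_prod_type]
      have hterm : ∀ j, ∑ b, N * ρ' (j, b) * ev F.θ (ψ' (j, b)) =
          N ^ 2 * (ρ j * ev F.θ (ψ j)) := by
        intro j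
        conv_rhs => rw [hrep _ (hρK j), Finset.sum_mul, Finset.mul_sum]
        refine Finset.sum_congr rfl fun b _ => ?_
        simp only [ψ']
        rw [ev_mul (polynomial_mem_tate _ _) (ht _) F.norm_θ_lt_R, ev_polynomial, eval_C]
        simp only [ρ']
        ring
      rw [Finset.sum_congr rfl fun j _ => hterm j, ← Finset.mul_sum, hrel, mul_zero])
  refine ⟨fun j => ∑ b, h' (j, b) * C (N * ω b), fun h0 => hh'0 ?_, ?_⟩
  · ext ⟨j, b⟩ n
    have h1 := congrArg (fun f : K[X] => f.coeff n) (congrFun h0 j)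
    simp only [finsetSum_coeff, coeff_mul_C, Pi.zero_apply, coeff_zero] at h1
    have h2 : ∑ b, (⟨(h' (j, b)).coeff n, F.mem_P_of_mem_W (hh'W (j, b) n)⟩ : F.P) • ω b = 0 := by
      have : N * ∑ b, (h' (j, b)).coeff n * ω b = 0 := by
        rw [← h1, Finset.mul_sum]
        exact Finset.sum_congr rfl fun b _ => by ring
      exact (mul_eq_zero.1 this).resolve_left hN0
    have h3 := Fintype.linearIndependent_iff.1 hind _ h2 b
    simpa using congrArg Subtype.val h3
  · rw [← hh', form, form, Fintype.sum_prod_type]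
    refine Finset.sum_congr rfl fun j _ => ?_
    rw [← coeToPowerSeries.ringHom_apply, map_sum, Finset.sum_mul]
    refine Finset.sum_congr rfl fun b _ => ?_
    simp only [ψ', coeToPowerSeries.ringHom_apply, Polynomial.coe_mul, mul_assoc]

end Relation

end CarlitzData

end CarlitzLog

namespace CarlitzLog

namespace CarlitzData

open Polynomial

section Exponential

variable {K : Type*} [NormedField K] [IsUltrametricDist K] (F : CarlitzData K)

/-- The coefficients of the Carlitz exponential. -/
noncomputable def expCoeff (i : ℕ) : K :=
  (∏ j ∈ Finset.range i, (F.θ ^ F.q ^ i - F.θ ^ F.q ^ j))⁻¹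

/-- The Carlitz exponential. -/
noncomputable def exp (z : K) : K := ∑' i, z ^ F.q ^ i * F.expCoeff i

omit [IsUltrametricDist K] in
theorem norm_θ : ‖F.θ‖ = F.q := F.norm_th_zero

omit [IsUltrametricDist K] in
theorem θ_ne_zero : F.θ ≠ 0 := by
  rw [← norm_pos_iff, F.norm_θ]
  linarith [F.two_le_real]

theorem norm_θ_pow_sub {i j : ℕ} (h : j < i) :
    ‖F.θ ^ F.q ^ i - F.θ ^ F.q ^ j‖ = (F.q : ℝ) ^ F.q ^ i := by
  have h2 := F.two_le_real
  have hlt : ‖-F.θ ^ F.q ^ j‖ < ‖F.θ ^ F.q ^ i‖ := by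
    rw [norm_neg, norm_pow, norm_pow, F.norm_θ]
    exact pow_lt_pow_right₀ (by linarith) (Nat.pow_lt_pow_right F.two_le h)
  rw [sub_eq_add_neg, IsUltrametricDist.norm_add_eq_max_of_norm_ne_norm hlt.ne', max_eq_left hlt.le,
    norm_pow, F.norm_θ]

theorem norm_expCoeff (i : ℕ) : ‖F.expCoeff i‖ = (((F.q : ℝ) ^ i) ^ F.q ^ i)⁻¹ := by
  rw [expCoeff, norm_inv, norm_prod, Finset.prod_congr rfl fun j hj =>
    F.norm_θ_pow_sub (Finset.mem_range.1 hj), Finset.prod_const, Finset.card_range, ← pow_mul,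
    ← pow_mul, mul_comm]

theorem norm_expCoeff_le (i : ℕ) : ‖F.expCoeff i‖ ≤ 1 := by
  rw [norm_expCoeff]
  have h2 := F.two_le_real
  exact inv_le_one_of_one_le₀ (one_le_pow₀ (one_le_pow₀ (by linarith)))

theorem expCoeff_succ (i : ℕ) :
    (F.θ ^ F.q ^ (i + 1) - F.θ) * F.expCoeff (i + 1) = F.expCoeff i ^ F.q := by
  have h0 : F.θ ^ F.q ^ (i + 1) - F.θ ≠ 0 := by
    have := F.norm_θ_pow_sub (Nat.succ_pos i)
    rw [pow_zero, pow_one] at this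
    rw [← norm_pos_iff, this]
    have h2 := F.two_le_real
    positivity
  have hφ : ∀ j, (F.θ ^ F.q ^ i - F.θ ^ F.q ^ j) ^ F.q =
      F.θ ^ F.q ^ (i + 1) - F.θ ^ F.q ^ (j + 1) := fun j => by
    rw [← F.φ_apply, map_sub, F.φ_apply, F.φ_apply, ← pow_mul, ← pow_mul, ← pow_succ, ← pow_succ]
  rw [expCoeff, expCoeff, Finset.prod_range_succ', inv_pow, ← Finset.prod_pow,
    Finset.prod_congr rfl fun j _ => hφ j, pow_zero, pow_one, mul_inv_rev,
    mul_inv_cancel_left₀ h0]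

variable [CompleteSpace K]

theorem hasSum_exp (z : K) : HasSum (fun i => z ^ F.q ^ i * F.expCoeff i) (F.exp z) := by
  have h2 := F.two_le_real
  refine (NonarchimedeanAddGroup.summable_of_tendsto_cofinite_zero ?_).hasSum
  rw [Nat.cofinite_eq_atTop, tendsto_zero_iff_norm_tendsto_zero]
  have hev : ∀ᶠ i : ℕ in atTop, 2 * ‖z‖ ≤ (F.q : ℝ) ^ i :=
    (tendsto_pow_atTop_atTop_of_one_lt (by linarith)).eventually_ge_atTop _
  refine squeeze_zero' (Eventually.of_forall fun _ => norm_nonneg _) ?_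
    (tendsto_pow_atTop_nhds_zero_of_lt_one (r := (1 / 2 : ℝ)) (by norm_num) (by norm_num))
  filter_upwards [hev] with i hi
  have hqi : (0 : ℝ) < (F.q : ℝ) ^ i := by positivity
  rw [norm_mul, norm_pow, norm_expCoeff, ← inv_pow, ← mul_pow]
  have h1 : ‖z‖ * ((F.q : ℝ) ^ i)⁻¹ ≤ 1 / 2 := by
    rw [← div_eq_mul_inv, div_le_iff₀ hqi]
    linarith
  calc _ ≤ (1 / 2 : ℝ) ^ F.q ^ i := by gcongr
    _ ≤ (1 / 2 : ℝ) ^ i := pow_le_pow_of_le_one (by norm_num) (by norm_num)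
        (Nat.lt_pow_self F.two_le).le

theorem exp_θ_mul (z : K) : F.exp (F.θ * z) = F.θ * F.exp z + F.exp z ^ F.q := by
  have h1 := (F.hasSum_exp (F.θ * z)).sub ((F.hasSum_exp z).mul_left F.θ)
  have h2 := (F.hasSum_exp z).map F.φ F.continuous_φ
  have h3 := (hasSum_nat_add_iff' 1).2 h1
  simp only [Finset.sum_range_one, pow_zero, pow_one] at h3
  have h4 : (fun i => (F.θ * z) ^ F.q ^ (i + 1) * F.expCoeff (i + 1) -
      F.θ * (z ^ F.q ^ (i + 1) * F.expCoeff (i + 1))) =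
      F.φ ∘ fun i => z ^ F.q ^ i * F.expCoeff i := by
    funext i
    rw [Function.comp_apply, F.φ_apply, mul_pow (z ^ F.q ^ i), ← F.expCoeff_succ, mul_pow,
      ← pow_mul, ← pow_succ]
    ring
  rw [h4] at h3
  have h5 := h3.unique h2
  rw [F.φ_apply] at h5
  rw [← h5]
  ring

theorem norm_exp_sub_le {z : K} (hz : ‖z‖ ≤ 1) : ‖F.exp z - z‖ ≤ ‖z‖ ^ 2 := by
  have h1 := (hasSum_nat_add_iff' 1).2 (F.hasSum_exp z)
  have h0 : F.expCoeff 0 = 1 := by simp [expCoeff]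
  simp only [Finset.sum_range_one, pow_zero, pow_one, h0, mul_one] at h1
  rw [← h1.tsum_eq]
  refine IsUltrametricDist.norm_tsum_le_of_forall_le_of_nonneg (by positivity) fun i => ?_
  rw [norm_mul, norm_pow]
  calc _ ≤ ‖z‖ ^ F.q ^ (i + 1) * 1 := by gcongr; exact F.norm_expCoeff_le _
    _ = ‖z‖ ^ F.q ^ (i + 1) := mul_one _
    _ ≤ ‖z‖ ^ 2 := pow_le_pow_of_le_one (norm_nonneg _) hz
        (F.two_le.trans (Nat.le_self_pow (Nat.succ_ne_zero i) _))

theorem norm_exp_le {z : K} (hz : ‖z‖ ≤ 1) : ‖F.exp z‖ ≤ ‖z‖ := by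
  have h := F.norm_exp_sub_le hz
  have h2 : ‖z‖ ^ 2 ≤ ‖z‖ := pow_le_of_le_one (norm_nonneg _) hz two_ne_zero
  calc ‖F.exp z‖ = ‖(F.exp z - z) + z‖ := by rw [sub_add_cancel]
    _ ≤ max ‖F.exp z - z‖ ‖z‖ := IsUltrametricDist.norm_add_le_max _ _
    _ ≤ ‖z‖ := max_le (h.trans h2) le_rfl

end Exponential

section Logarithm

variable {K : Type*} [NormedField K] [IsUltrametricDist K] (F : CarlitzData K)

/-- The twisting factor `t - θ^q`. -/
noncomputable def T : K[X] := X - C (F.θ ^ F.q)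

omit [IsUltrametricDist K] in
theorem coeff_T_mul_zero (f : PowerSeries K) :
    PowerSeries.coeff 0 ((F.T : PowerSeries K) * f) = -(F.θ ^ F.q * PowerSeries.coeff 0 f) := by
  simp [T, sub_mul]

omit [IsUltrametricDist K] in
theorem coeff_T_mul_succ (f : PowerSeries K) (n : ℕ) :
    PowerSeries.coeff (n + 1) ((F.T : PowerSeries K) * f) =
      PowerSeries.coeff n f - F.θ ^ F.q * PowerSeries.coeff (n + 1) f := by
  rw [T, coe_sub, coe_X, coe_C, sub_mul, map_sub, PowerSeries.coeff_succ_X_mul,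
    PowerSeries.coeff_C_mul]

theorem mem_tate_of_eventually_le {R : NNReal} {f : PowerSeries K} {B : ℝ}
    (h : ∀ᶠ n in atTop, ‖PowerSeries.coeff n f‖ * (R : ℝ) ^ n ≤ B) : f ∈ tate K R := by
  obtain ⟨C, hC⟩ := (isBoundedUnder_of_eventually_le h).bddAbove_range
  exact ⟨C, fun n => hC ⟨n, rfl⟩⟩

variable [CompleteSpace K]

/-- The deformation of a Carlitz logarithm. -/
theorem exists_logSeries (l : K) : ∃ L ∈ tate K F.R,
    F.τ L = (F.T : PowerSeries K) * (L - PowerSeries.C (F.exp l)) ∧ ev F.θ L = l := by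
  have h2 := F.two_le_real
  have hθ0 := F.θ_ne_zero
  set e : ℕ → K := fun n => F.exp (l / F.θ ^ n) with he
  have hrec : ∀ n, e n = F.θ * e (n + 1) + e (n + 1) ^ F.q := by
    intro n
    simp only [he]
    rw [← F.exp_θ_mul]
    congr 1
    rw [pow_succ]
    field_simp
  have hnorm : ∀ n, ‖l / F.θ ^ n‖ = ‖l‖ / (F.q : ℝ) ^ n := by
    intro n
    rw [norm_div, norm_pow, F.norm_θ]
  have hev : ∀ᶠ n : ℕ in atTop, ‖l / F.θ ^ n‖ ≤ 1 := by
    have : ∀ᶠ i : ℕ in atTop, ‖l‖ ≤ (F.q : ℝ) ^ i :=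
      (tendsto_pow_atTop_atTop_of_one_lt (by linarith)).eventually_ge_atTop _
    filter_upwards [this] with n hn
    rw [hnorm, div_le_one (by positivity)]
    exact hn
  have he0 : e 0 = F.exp l := by simp [he]
  set L' : PowerSeries K := PowerSeries.mk fun n => -(e (n + 1) ^ F.q) with hL'
  have hτneg : ∀ x : K, (-x) ^ F.q = -(x ^ F.q) := fun x => by
    rw [← F.φ_apply, ← F.φ_apply, map_neg]
  have hL't : L' ∈ tate K F.R := by
    refine mem_tate_of_eventually_le (B := ‖l‖ ^ 2) ?_
    filter_upwards [(tendsto_add_atTop_nat 1).eventually hev] with n hn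
    rw [hL', PowerSeries.coeff_mk, norm_neg, norm_pow, F.coe_R, ← pow_mul, mul_comm 2, pow_mul]
    have h3 : ‖e (n + 1)‖ ≤ ‖l‖ / (F.q : ℝ) ^ (n + 1) := by
      rw [← hnorm]; exact F.norm_exp_le hn
    have h4 : ‖e (n + 1)‖ ≤ 1 := (F.norm_exp_le hn).trans hn
    calc _ ≤ ‖e (n + 1)‖ ^ 2 * ((F.q : ℝ) ^ n) ^ 2 :=
          mul_le_mul_of_nonneg_right (pow_le_pow_of_le_one (norm_nonneg _) h4 F.two_le)
            (by positivity)
      _ = (‖e (n + 1)‖ * (F.q : ℝ) ^ n) ^ 2 := by rw [mul_pow]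
      _ ≤ ‖l‖ ^ 2 := by
          gcongr
          calc _ ≤ ‖l‖ / (F.q : ℝ) ^ (n + 1) * (F.q : ℝ) ^ n := by gcongr
            _ = ‖l‖ / F.q := by rw [pow_succ]; field_simp
            _ ≤ ‖l‖ := div_le_self (norm_nonneg _) (by linarith)
  have hC : (PowerSeries.C (F.exp l) : PowerSeries K) = ((C (F.exp l) : K[X]) : PowerSeries K) := by
    simp
  have hLt : L' + PowerSeries.C (F.exp l) ∈ tate K F.R :=
    add_mem hL't (by rw [hC]; exact polynomial_mem_tate _ _)
  refine ⟨L' + PowerSeries.C (F.exp l), hLt, ?_, ?_⟩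
  · rw [add_sub_cancel_right]
    ext n
    rw [coeff_τ, map_add, PowerSeries.coeff_C]
    cases n with
    | zero =>
      rw [coeff_T_mul_zero, hL', PowerSeries.coeff_mk, if_pos rfl, ← he0, hrec 0]
      rw [neg_add_eq_sub, add_sub_cancel_right]
      ring
    | succ n =>
      rw [coeff_T_mul_succ, hL', PowerSeries.coeff_mk, PowerSeries.coeff_mk,
        if_neg (Nat.succ_ne_zero n), add_zero, hτneg]
      conv_rhs => rw [hrec (n + 1), ← F.φ_apply, map_add, map_mul, F.φ_apply, F.φ_apply, F.φ_apply]
      ring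
  · have hs := (hasSum_ev hLt F.norm_θ_lt_R).tendsto_sum_nat
    refine tendsto_nhds_unique hs ?_
    have hpart : ∀ n, ∑ i ∈ Finset.range (n + 1),
        PowerSeries.coeff i (L' + PowerSeries.C (F.exp l)) * F.θ ^ i = F.θ ^ (n + 1) * e (n + 1) := by
      intro n
      induction n with
      | zero =>
        rw [Finset.sum_range_one, map_add, hL', PowerSeries.coeff_mk, PowerSeries.coeff_C,
          if_pos rfl, ← he0, hrec 0]
        ring
      | succ n ih =>
        rw [Finset.sum_range_succ, ih, map_add, hL', PowerSeries.coeff_mk, PowerSeries.coeff_C,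
          if_neg (Nat.succ_ne_zero n), hrec (n + 1)]
        ring
    rw [← tendsto_add_atTop_iff_nat 1]
    refine Tendsto.congr (fun n => (hpart n).symm) ?_
    rw [tendsto_iff_norm_sub_tendsto_zero]
    have hlim : Tendsto (fun n : ℕ => ‖l‖ ^ 2 * ((F.q : ℝ)⁻¹) ^ (n + 1)) atTop (nhds 0) := by
      have := ((tendsto_pow_atTop_nhds_zero_of_lt_one (r := (F.q : ℝ)⁻¹) (by positivity)
        (inv_lt_one_of_one_lt₀ (by linarith))).comp (tendsto_add_atTop_nat 1)).const_mul (‖l‖ ^ 2)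
      simpa using this
    refine squeeze_zero' (Eventually.of_forall fun _ => norm_nonneg _) ?_ hlim
    filter_upwards [(tendsto_add_atTop_nat 1).eventually hev] with n hn
    have hpow : F.θ ^ (n + 1) ≠ 0 := pow_ne_zero _ hθ0
    have : F.θ ^ (n + 1) * e (n + 1) - l =
        F.θ ^ (n + 1) * (e (n + 1) - l / F.θ ^ (n + 1)) := by field_simp
    rw [this, norm_mul, norm_pow, F.norm_θ]
    calc _ ≤ (F.q : ℝ) ^ (n + 1) * ‖l / F.θ ^ (n + 1)‖ ^ 2 := by
          gcongr
          exact F.norm_exp_sub_le hn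
      _ = ‖l‖ ^ 2 * ((F.q : ℝ)⁻¹) ^ (n + 1) := by
          rw [hnorm, inv_pow]; field_simp

end Logarithm

section Period

variable {K : Type*} [NormedField K] [IsUltrametricDist K] (F : CarlitzData K)

omit [IsUltrametricDist K] in
theorem pow_card_le_norm_prod (s : Multiset K) {c : ℝ} (hc : 0 ≤ c) (h : ∀ x ∈ s, c ≤ ‖x‖) :
    c ^ s.card ≤ ‖s.prod‖ := by
  induction s using Multiset.induction_on with
  | empty => simp
  | cons a s ih =>
    rw [Multiset.card_cons, Multiset.prod_cons, norm_mul, pow_succ']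
    exact mul_le_mul (h a (Multiset.mem_cons_self a s))
      (ih fun x hx => h x (Multiset.mem_cons_of_mem hx)) (by positivity) (norm_nonneg _)

theorem exists_small_root [IsAlgClosed K] {A : ℝ} (hA : A ^ (F.q - 1) = (F.q : ℝ) ^ F.q)
    (hA0 : 0 ≤ A) {b : K} (hb : ‖b‖ ≤ A) :
    ∃ x : K, x ^ F.q + F.θ ^ F.q * x = b ∧ ‖b‖ = (F.q : ℝ) ^ F.q * ‖x‖ := by
  have h2 := F.two_le_real
  have hq2 := F.two_le
  have hqq : (1 : ℝ) < (F.q : ℝ) ^ F.q := one_lt_pow₀ (by linarith) F.q_ne_zero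
  have hA1 : 1 < A := by
    by_contra! h
    have := pow_le_one₀ (n := F.q - 1) hA0 h
    linarith
  set g : K[X] := X ^ F.q + (C (F.θ ^ F.q) * X - C b) with hg
  have hdeg : (C (F.θ ^ F.q) * X - C b).degree < (F.q : WithBot ℕ) := by
    refine lt_of_le_of_lt (b := (1 : WithBot ℕ)) ?_ (by exact_mod_cast hq2)
    refine (degree_sub_le _ _).trans (max_le ?_ ?_)
    · exact (degree_C_mul_X_le _)
    · exact degree_C_le.trans (by norm_num)
  have hmonic : g.Monic := monic_X_pow_add hdeg
  have hnat : g.natDegree = F.q := by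
    refine natDegree_eq_of_degree_eq_some ?_
    rw [hg, degree_add_eq_left_of_degree_lt (by rwa [degree_X_pow]), degree_X_pow]
  have hsplit := IsAlgClosed.splits g
  have hcard : g.roots.card = F.q := by rw [← hnat]; exact hsplit.natDegree_eq_card_roots.symm
  obtain ⟨x, hx, hxA⟩ : ∃ x ∈ g.roots, ‖x‖ < A := by
    by_contra! h
    have h1 := pow_card_le_norm_prod g.roots hA0 h
    have h3 : ‖g.roots.prod‖ = ‖b‖ := by
      have := hsplit.coeff_zero_eq_prod_roots_of_monic hmonic
      have h0 : g.coeff 0 = -b := by simp [hg, Ne.symm F.q_ne_zero]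
      rw [h0] at this
      have := congrArg norm this
      simpa using this.symm
    rw [hcard, h3] at h1
    have h4 : A < A ^ F.q := lt_self_pow₀ hA1 hq2
    linarith
  have hxr : x ^ F.q + F.θ ^ F.q * x = b := by
    have := (mem_roots'.1 hx).2
    simp only [hg, IsRoot, eval_add, eval_pow, eval_X, eval_sub, eval_mul, eval_C] at this
    rw [← sub_eq_zero, ← this]
    ring
  refine ⟨x, hxr, ?_⟩
  by_cases hx0 : x = 0
  · rw [← hxr, hx0]
    simp [F.q_ne_zero]
  have hxpos := norm_pos_iff.2 hx0
  have hlt : ‖x ^ F.q‖ < ‖F.θ ^ F.q * x‖ := by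
    rw [norm_mul, norm_pow, norm_pow, F.norm_θ, ← hA]
    calc ‖x‖ ^ F.q = ‖x‖ ^ (F.q - 1) * ‖x‖ := by
          rw [← pow_succ]; congr 1; omega
      _ < A ^ (F.q - 1) * ‖x‖ := by
          gcongr
          omega
  rw [← hxr, IsUltrametricDist.norm_add_eq_max_of_norm_ne_norm hlt.ne, max_eq_right hlt.le,
    norm_mul, norm_pow, F.norm_θ]

/-- The fundamental solution of `τ L = T L`. -/
theorem exists_periodSeries [IsAlgClosed K] : ∃ L ∈ tate K F.R,
    PowerSeries.coeff 0 L ≠ 0 ∧ F.τ L = (F.T : PowerSeries K) * L ∧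
    ∀ f ∈ tate K F.R, F.τ f = (F.T : PowerSeries K) * f →
      ∃ c : K[X], (∀ n, c.coeff n ∈ F.Fq) ∧ f = c * L := by
  have h2 := F.two_le_real
  have hq2 := F.two_le
  have hqq : (1 : ℝ) < (F.q : ℝ) ^ F.q := one_lt_pow₀ (by linarith) F.q_ne_zero
  obtain ⟨a₀, ha₀⟩ := IsAlgClosed.exists_pow_nat_eq (-(F.θ ^ F.q)) (n := F.q - 1) (by omega)
  have hA : ‖a₀‖ ^ (F.q - 1) = (F.q : ℝ) ^ F.q := by
    rw [← norm_pow, ha₀, norm_neg, norm_pow, F.norm_θ]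
  have ha₀0 : a₀ ≠ 0 := by
    rintro rfl
    rw [norm_zero, zero_pow (by omega)] at hA
    linarith
  have ha₀q : a₀ ^ F.q = -(F.θ ^ F.q * a₀) := by
    rw [← neg_mul, ← ha₀, ← pow_succ]
    congr 1
    omega
  have hex : ∀ b : {b : K // ‖b‖ ≤ ‖a₀‖}, ∃ x : {b : K // ‖b‖ ≤ ‖a₀‖},
      (x : K) ^ F.q + F.θ ^ F.q * x = b ∧ ‖(b : K)‖ = (F.q : ℝ) ^ F.q * ‖(x : K)‖ := by
    rintro ⟨b, hb⟩
    obtain ⟨x, hx, hx'⟩ := F.exists_small_root hA (norm_nonneg _) hb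
    refine ⟨⟨x, le_trans ?_ hb⟩, hx, hx'⟩
    rw [hx']
    exact le_mul_of_one_le_left (norm_nonneg _) hqq.le
  choose r hr hr' using hex
  set a : ℕ → K := fun n => ((r^[n] ⟨a₀, le_rfl⟩ : {b : K // ‖b‖ ≤ ‖a₀‖}) : K) with ha
  have ha0 : a 0 = a₀ := rfl
  have hsucc : ∀ n, a (n + 1) ^ F.q + F.θ ^ F.q * a (n + 1) = a n := by
    intro n
    simp only [ha, Function.iterate_succ_apply']
    exact hr _
  have hnsucc : ∀ n, ‖a n‖ = (F.q : ℝ) ^ F.q * ‖a (n + 1)‖ := by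
    intro n
    simp only [ha, Function.iterate_succ_apply']
    exact hr' _
  have hapos : ∀ n, 0 < ‖a n‖ := by
    intro n
    induction n with
    | zero => exact norm_pos_iff.2 ha₀0
    | succ n ih =>
      rw [hnsucc n] at ih
      exact pos_of_mul_pos_right ih (by positivity)
  have hlt : ∀ n, ‖a (n + 1)‖ < ‖a 0‖ := by
    have hstep : ∀ n, ‖a (n + 1)‖ < ‖a n‖ := fun n => by
      rw [hnsucc n]
      exact lt_mul_of_one_lt_left (hapos _) hqq
    intro n
    exact strictAnti_nat_of_succ_lt (f := fun n => ‖a n‖) hstep (Nat.succ_pos n)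
  set L : PowerSeries K := PowerSeries.mk a with hL
  have hL0 : PowerSeries.coeff 0 L ≠ 0 := by rw [hL, PowerSeries.coeff_mk]; exact ha₀0
  have hτL : F.τ L = (F.T : PowerSeries K) * L := by
    ext n
    rw [coeff_τ]
    cases n with
    | zero => rw [coeff_T_mul_zero, hL, PowerSeries.coeff_mk, ha0, ha₀q]
    | succ n =>
      rw [coeff_T_mul_succ, hL, PowerSeries.coeff_mk, PowerSeries.coeff_mk, ← hsucc n]
      ring
  have hLt : L ∈ tate K F.R := by
    refine ⟨‖a₀‖, fun n => ?_⟩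
    rw [hL, PowerSeries.coeff_mk, F.coe_R]
    induction n with
    | zero => simp [ha0]
    | succ n ih =>
      refine le_trans ?_ ih
      rw [hnsucc n, pow_succ]
      have : (F.q : ℝ) ^ 2 ≤ (F.q : ℝ) ^ F.q := pow_le_pow_right₀ (by linarith) hq2
      calc _ = (F.q : ℝ) ^ 2 * ‖a (n + 1)‖ * ((F.q : ℝ) ^ 2) ^ n := by ring
        _ ≤ _ := by gcongr
  refine ⟨L, hLt, hL0, hτL, fun f hf hτf => ?_⟩
  have hLL : L * L⁻¹ = 1 := PowerSeries.mul_inv_cancel L (by simpa using hL0)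
  have hL_ne : L ≠ 0 := by
    intro h
    rw [h, map_zero] at hL0
    exact hL0 rfl
  have hT_ne : (F.T : PowerSeries K) ≠ 0 := by
    intro h
    have : F.T = 0 := Polynomial.coe_injective K (by simpa using h)
    exact X_sub_C_ne_zero _ this
  set c := f * L⁻¹ with hc
  have hfc : f = c * L := by rw [hc, mul_assoc, mul_comm L⁻¹, hLL, mul_one]
  have hτc : F.τ c = c := by
    have h1 : F.τ c * ((F.T : PowerSeries K) * L) = c * ((F.T : PowerSeries K) * L) := by
      rw [← hτL, ← map_mul, ← hfc, hτf, hfc, hτL]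
      ring
    exact mul_right_cancel₀ (mul_ne_zero hT_ne hL_ne) h1
  have hcF : ∀ n, PowerSeries.coeff n c ∈ F.Fq := by
    intro n
    have := congrArg (PowerSeries.coeff n) hτc
    rwa [τ, PowerSeries.coeff_map] at this
  have hnormf : ∀ n, PowerSeries.coeff n c ≠ 0 → ‖PowerSeries.coeff n f‖ = ‖a₀‖ := by
    classical
    intro n hn
    have h1 : ‖PowerSeries.coeff n c * PowerSeries.coeff 0 L‖ = ‖a₀‖ := by
      rw [norm_mul, F.norm_Fq (hcF n) hn, one_mul, hL, PowerSeries.coeff_mk, ha0]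
    have hmem : (n, 0) ∈ Finset.HasAntidiagonal.antidiagonal n := by simp
    rw [hfc, PowerSeries.coeff_mul, ← Finset.add_sum_erase _ _ hmem]
    have hlt' : ‖∑ x ∈ (Finset.HasAntidiagonal.antidiagonal n).erase (n, 0),
        PowerSeries.coeff x.1 c * PowerSeries.coeff x.2 L‖ <
        ‖PowerSeries.coeff n c * PowerSeries.coeff 0 L‖ := by
      rw [h1]
      rcases ((Finset.HasAntidiagonal.antidiagonal n).erase (n, 0)).eq_empty_or_nonempty with h | h
      · rw [h, Finset.sum_empty, norm_zero]
        exact hapos 0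
      · obtain ⟨x, hx, hle⟩ := IsUltrametricDist.exists_norm_finsetSum_le_of_nonempty h
          (fun x => PowerSeries.coeff x.1 c * PowerSeries.coeff x.2 L)
        refine hle.trans_lt ?_
        rw [Finset.mem_erase, Finset.HasAntidiagonal.mem_antidiagonal] at hx
        have hx2 : x.2 ≠ 0 := fun h => hx.1 (Prod.ext (by simp; omega) h)
        obtain ⟨k, hk⟩ := Nat.exists_eq_succ_of_ne_zero hx2
        rw [norm_mul, hk, hL, PowerSeries.coeff_mk]
        calc _ ≤ 1 * ‖a (k + 1)‖ := by
              gcongr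
              exact F.norm_Fq_le ⟨_, hcF x.1⟩
          _ < ‖a₀‖ := by rw [one_mul]; exact hlt k
    rw [IsUltrametricDist.norm_add_eq_max_of_norm_ne_norm hlt'.ne', max_eq_left hlt'.le, h1]
  obtain ⟨N, hN⟩ := eventually_atTop.1
    ((tendsto_norm_coeff F.one_lt_R hf).eventually (gt_mem_nhds (hapos 0)))
  have hc0 : ∀ n, N ≤ n → PowerSeries.coeff n c = 0 := by
    intro n hn
    by_contra h
    exact (hN n hn).ne (hnormf n h)
  have htrunc : ∀ n, (PowerSeries.trunc N c).coeff n = PowerSeries.coeff n c := by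
    intro n
    rw [PowerSeries.coeff_trunc]
    split_ifs with h
    · rfl
    · exact (hc0 n (not_lt.1 h)).symm
  refine ⟨PowerSeries.trunc N c, fun n => by rw [htrunc]; exact hcF n, ?_⟩
  rw [hfc]
  congr 1
  ext n
  rw [Polynomial.coeff_coe, htrunc]

end Period

end CarlitzData

end CarlitzLog

namespace CarlitzLog

open scoped Polynomial
open MvPolynomial

section Twist

variable {K σ : Type*} [Field K] (φ : K →+* K) (T : K[X]) (α : σ → K[X])

/-- The ring endomorphism acting as `φ` on the coefficients and substituting `T (X i - α i)`
for `X i`. -/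
noncomputable def twist : MvPolynomial σ K[X] →+* MvPolynomial σ K[X] :=
  eval₂Hom (C.comp (Polynomial.mapRingHom φ)) fun i => C T * (X i - C (α i))

/-- Nonzero polynomials `S` with `u S' = T^m τ(u) S`, where `S'` is the twist of `S`. -/
def IsEigen (m : ℕ) (S : MvPolynomial σ K[X]) : Prop :=
  S ≠ 0 ∧ ∃ u : K[X], u ≠ 0 ∧ C u * twist φ T α S = C (T ^ m * u.map φ) * S

@[simp]
theorem twist_C (a : K[X]) : twist φ T α (C a) = C (a.map φ) := by
  simp [twist]

@[simp]
theorem twist_X (i : σ) : twist φ T α (X i) = C T * (X i - C (α i)) := by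
  simp [twist]

theorem coeff_mul_of_degree {f g : MvPolynomial σ K[X]} {a b : ℕ}
    (hf : ∀ ν, a ≤ ν.degree → coeff ν f = 0) (hg : ∀ ν, b < ν.degree → coeff ν g = 0) {ν : σ →₀ ℕ}
    (hν : a + b ≤ ν.degree) : coeff ν (f * g) = 0 := by
  classical
  rw [coeff_mul]
  refine Finset.sum_eq_zero fun x hx => ?_
  rw [Finset.HasAntidiagonal.mem_antidiagonal] at hx
  have h1 : x.1.degree + x.2.degree = ν.degree := by rw [← hx, map_add]
  rcases le_or_gt a x.1.degree with h | h
  · rw [hf _ h, zero_mul]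
  · rw [hg _ (by omega), mul_zero]

theorem coeff_eq_zero_of_totalDegree_lt_degree {f : MvPolynomial σ K[X]} {ν : σ →₀ ℕ}
    (h : f.totalDegree < ν.degree) : coeff ν f = 0 :=
  coeff_eq_zero_of_totalDegree_lt h

theorem coeff_twist_monomial_sub (μ ν : σ →₀ ℕ) (h : μ.degree ≤ ν.degree) :
    coeff ν (twist φ T α (monomial μ 1) - monomial μ (T ^ μ.degree)) = 0 := by
  classical
  have hmon : ∀ (μ ν : σ →₀ ℕ) (a : K[X]), μ.degree < ν.degree → coeff ν (monomial μ a) = 0 := by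
    intro μ ν a h
    rw [coeff_monomial, if_neg]
    rintro rfl
    exact h.false
  induction μ using Finsupp.induction_linear generalizing ν with
  | zero => simp [show (monomial 0 (1 : K[X]) : MvPolynomial σ K[X]) = 1 from rfl]
  | add f g hf hg =>
    have h1 : (monomial (f + g) (1 : K[X]) : MvPolynomial σ K[X]) = monomial f 1 * monomial g 1 := by
      rw [monomial_mul, one_mul]
    have h2 : (monomial (f + g) (T ^ (f + g).degree) : MvPolynomial σ K[X]) =
        monomial f (T ^ f.degree) * monomial g (T ^ g.degree) := by
      rw [monomial_mul, map_add, pow_add]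
    rw [map_add] at h
    have hgt : ∀ ν : σ →₀ ℕ, g.degree < ν.degree → coeff ν (twist φ T α (monomial g 1)) = 0 := by
      intro ν hν
      have := hg ν hν.le
      rwa [coeff_sub, hmon _ _ _ hν, sub_zero] at this
    rw [h1, map_mul, h2, show ∀ a b c d : MvPolynomial σ K[X],
      a * b - c * d = (a - c) * b + (b - d) * c from fun a b c d => by ring, coeff_add,
      coeff_mul_of_degree hf hgt h, coeff_mul_of_degree hg (fun ν hν => hmon f ν _ hν) (by omega),
      add_zero]
  | single i n =>
    induction n generalizing ν with
    | zero => simp [show (monomial 0 (1 : K[X]) : MvPolynomial σ K[X]) = 1 from rfl]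
    | succ n ih =>
      have hd : ∀ n : ℕ, (Finsupp.single i n).degree = n := fun n => Finsupp.degree_single i n
      have h1 : ∀ a : K[X], (monomial (Finsupp.single i (n + 1)) (a * T) : MvPolynomial σ K[X]) =
          monomial (Finsupp.single i n) a * (C T * X i) := by
        intro a
        rw [C_mul_X_eq_monomial, monomial_mul, ← Finsupp.single_add]
      have h1' : (monomial (Finsupp.single i (n + 1)) 1 : MvPolynomial σ K[X]) =
          monomial (Finsupp.single i n) 1 * X i := by
        rw [X, monomial_mul, ← Finsupp.single_add, one_mul]
      rw [hd] at h ih ⊢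
      rw [h1', pow_succ, h1, map_mul, twist_X, show ∀ a b c d e : MvPolynomial σ K[X],
        a * (d * (b - e)) - c * (d * b) = (a - c) * (d * (b - e)) + (-(d * e)) * c from
        fun a b c d e => by ring, coeff_add]
      rw [coeff_mul_of_degree (a := n) (b := 1) (fun ν hν => ih ν hν) _ h, zero_add,
        coeff_mul_of_degree (a := 1) (b := n) _ (fun ν hν => hmon _ ν _ (by rwa [hd])) (by omega)]
      · intro ν hν
        rw [← C_mul, ← C_neg, coeff_C, if_neg]
        rintro rfl
        simp at hν
      · intro ν hν
        rw [mul_sub, C_mul_X_eq_monomial, ← C_mul, coeff_sub, hmon _ _ _ (by rwa [hd]), coeff_C,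
          if_neg, sub_zero]
        rintro rfl
        simp at hν

theorem twist_eq_sum (S : MvPolynomial σ K[X]) : twist φ T α S =
    ∑ μ ∈ S.support, C ((coeff μ S).map φ) * twist φ T α (monomial μ 1) := by
  conv_lhs => rw [S.as_sum]
  rw [map_sum]
  refine Finset.sum_congr rfl fun μ _ => ?_
  rw [← twist_C φ T α, ← map_mul, C_mul_monomial, mul_one]

theorem coeff_twist (S : MvPolynomial σ K[X]) {ν : σ →₀ ℕ} (h : S.totalDegree ≤ ν.degree) :
    coeff ν (twist φ T α S) = T ^ ν.degree * (coeff ν S).map φ := by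
  classical
  have hsum : ∑ μ ∈ S.support, (coeff μ S).map φ * coeff ν (monomial μ (T ^ μ.degree)) =
      T ^ ν.degree * (coeff ν S).map φ := by
    rw [Finset.sum_eq_single ν]
    · rw [coeff_monomial, if_pos rfl, mul_comm]
    · intro μ _ hμ
      rw [coeff_monomial, if_neg hμ, mul_zero]
    · intro hν
      rw [notMem_support_iff.1 hν, Polynomial.map_zero, zero_mul]
  rw [twist_eq_sum, coeff_sum, ← hsum]
  refine Finset.sum_congr rfl fun μ hμ => ?_
  rw [coeff_C_mul]
  congr 1
  have := coeff_twist_monomial_sub φ T α μ ν ((le_totalDegree hμ).trans h)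
  rwa [coeff_sub, sub_eq_zero] at this

theorem pderiv_twist (i : σ) (S : MvPolynomial σ K[X]) :
    pderiv i (twist φ T α S) = C T * twist φ T α (pderiv i S) := by
  classical
  induction S using MvPolynomial.induction_on with
  | C a => simp
  | add f g hf hg => simp only [map_add, hf, hg, mul_add]
  | mul_X f j hf =>
    rw [map_mul, twist_X, pderiv_mul, hf, pderiv_mul, pderiv_mul, map_add, map_mul, map_mul,
      twist_X, map_sub, pderiv_C, pderiv_C, pderiv_X]
    by_cases hij : i = j
    · subst hij
      simp
      ring
    · simp [Pi.single_eq_of_ne (Ne.symm hij)]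
      ring

variable {φ T α}

theorem IsEigen.totalDegree_eq (hT : T.natDegree = 1) {m : ℕ} {S : MvPolynomial σ K[X]}
    (hS : IsEigen φ T α m S) : S.totalDegree = m := by
  obtain ⟨hS0, u, hu, h⟩ := hS
  have hT0 : T ≠ 0 := by rintro rfl; simp at hT
  obtain ⟨ν, hν, hνd⟩ := Finset.exists_mem_eq_sup S.support (support_nonempty.2 hS0)
    fun s => s.degree
  have hνd : S.totalDegree = ν.degree := hνd
  have hc := congrArg (coeff ν) h
  rw [coeff_C_mul, coeff_C_mul, coeff_twist φ T α S hνd.le] at hc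
  have hs := mem_support_iff.1 hν
  have hmap : ∀ f : K[X], f ≠ 0 → f.map φ ≠ 0 := fun f hf =>
    (Polynomial.map_ne_zero_iff φ.injective).2 hf
  have hdeg := congrArg Polynomial.natDegree hc
  rw [Polynomial.natDegree_mul hu (mul_ne_zero (pow_ne_zero _ hT0) (hmap _ hs)),
    Polynomial.natDegree_mul (pow_ne_zero _ hT0) (hmap _ hs),
    Polynomial.natDegree_mul (mul_ne_zero (pow_ne_zero _ hT0) (hmap _ hu)) hs,
    Polynomial.natDegree_mul (pow_ne_zero _ hT0) (hmap _ hu),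
    Polynomial.natDegree_pow, Polynomial.natDegree_pow, hT, Polynomial.natDegree_map,
    Polynomial.natDegree_map] at hdeg
  omega

theorem IsEigen.pderiv (hT : T ≠ 0) {m : ℕ} {S : MvPolynomial σ K[X]}
    (hS : IsEigen φ T α (m + 1) S) {i : σ} (hi : pderiv i S ≠ 0) :
    IsEigen φ T α m (pderiv i S) := by
  obtain ⟨-, u, hu, h⟩ := hS
  refine ⟨hi, u, hu, ?_⟩
  have h1 := congrArg (MvPolynomial.pderiv i) h
  rw [pderiv_C_mul, pderiv_C_mul, pderiv_twist] at h1
  have hCT : (C T : MvPolynomial σ K[X]) ≠ 0 := by rwa [Ne, C_eq_zero]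
  refine mul_left_cancel₀ hCT ?_
  rw [mul_left_comm, h1, ← mul_assoc, ← C_mul, pow_succ']
  congr 2
  ring

theorem coeff_X_mul_pderiv (i : σ) (S : MvPolynomial σ K[X]) (ν : σ →₀ ℕ) :
    coeff ν (X i * MvPolynomial.pderiv i S) = ν i * coeff ν S := by
  classical
  induction S using MvPolynomial.induction_on' with
  | monomial μ a =>
    rw [X_mul_pderiv_monomial, coeff_smul, coeff_monomial]
    split_ifs with h
    · rw [h, nsmul_eq_mul]
    · simp
  | add f g hf hg => rw [map_add, mul_add, coeff_add, hf, hg, coeff_add, mul_add]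

theorem exists_expand_of_pderiv_eq_zero (p : ℕ) [CharP K p] {S : MvPolynomial σ K[X]}
    (h : ∀ i, MvPolynomial.pderiv i S = 0) : ∃ Z, expand p Z = S := by
  have hdvd : ∀ ν ∈ S.support, ∀ i, p ∣ ν i := by
    intro ν hν i
    have := coeff_X_mul_pderiv i S ν
    rw [h i, mul_zero, coeff_zero, eq_comm, mul_eq_zero] at this
    rcases this with h | h
    · exact (CharP.cast_eq_zero_iff K[X] p _).1 h
    · exact absurd h (mem_support_iff.1 hν)
  refine ⟨∑ ν ∈ S.support, monomial (ν.mapRange (· / p) (Nat.zero_div p)) (coeff ν S), ?_⟩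
  conv_rhs => rw [S.as_sum]
  rw [map_sum]
  refine Finset.sum_congr rfl fun ν hν => ?_
  rw [expand_monomial]
  refine congrArg (fun μ => monomial μ (coeff ν S)) (Finsupp.ext fun i => ?_)
  simp [Nat.mul_div_cancel' (hdvd ν hν i)]

theorem coeff_smul_pow_char (p : ℕ) [Fact p.Prime] [CharP K p] (f : MvPolynomial σ K[X])
    (ν : σ →₀ ℕ) : coeff (p • ν) (f ^ p) = coeff ν f ^ p := by
  classical
  have hp : p ≠ 0 := (Fact.out : p.Prime).ne_zero
  induction f using MvPolynomial.induction_on' with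
  | monomial μ a =>
    rw [monomial_pow, coeff_monomial, coeff_monomial]
    by_cases h : μ = ν
    · rw [if_pos h, if_pos (by rw [h])]
    · rw [if_neg h, if_neg, zero_pow hp]
      intro h'
      refine h (Finsupp.ext fun i => ?_)
      have := DFunLike.congr_fun h' i
      simpa [hp] using this
  | add f g hf hg => rw [add_pow_char, coeff_add, hf, hg, coeff_add, add_pow_char]

/-- Additive projections of `K[X]` that are `p⁻¹`-linear and commute with `φ` separate points. -/
theorem exists_cartier (φ : K →+* K) (p : ℕ) [Fact p.Prime] [CharP K p] [PerfectRing K p]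
    {s : K[X]} (hs : s ≠ 0) : ∃ κ : K[X] →+ K[X], (∀ a b, κ (a ^ p * b) = a * κ b) ∧
      (∀ a, κ (a.map φ) = (κ a).map φ) ∧ κ s ≠ 0 := by
  have hp : p ≠ 0 := (Fact.out : p.Prime).ne_zero
  set ρ : K →+* K := ((frobeniusEquiv K p).symm : K →+* K) with hρ
  have hρ' : ∀ x, ρ (x ^ p) = x := fun x => (frobeniusEquiv K p).symm_apply_apply x
  have hρ'' : ∀ x, ρ x ^ p = x := fun x => (frobeniusEquiv K p).apply_symm_apply x
  have hcomm : ∀ x, ρ (φ x) = φ (ρ x) := fun x => by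
    conv_lhs => rw [← hρ'' x, map_pow, hρ']
  obtain ⟨n, hn⟩ : ∃ n, s.coeff n ≠ 0 := by
    by_contra! h
    exact hs (Polynomial.ext h)
  obtain ⟨j, k, hjk⟩ : ∃ j k, n + j = k * p := by
    refine ⟨n * p - n, n, ?_⟩
    have : n ≤ n * p := Nat.le_mul_of_pos_right n (Nat.pos_of_ne_zero hp)
    omega
  refine ⟨AddMonoidHom.mk' (fun a => (Polynomial.contract p (Polynomial.X ^ j * a)).map ρ)
    fun a b => by rw [mul_add, Polynomial.contract_add hp, Polynomial.map_add], ?_, ?_, ?_⟩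
  · intro a b
    simp only [AddMonoidHom.mk'_apply]
    rw [← Polynomial.map_frobenius_expand p a, Polynomial.map_expand, ← mul_assoc, mul_right_comm,
      Polynomial.contract_mul_expand hp, Polynomial.map_mul, Polynomial.map_map, mul_comm]
    congr 1
    have : ρ.comp (frobenius K p) = RingHom.id K := RingHom.ext hρ'
    rw [this, Polynomial.map_id]
  · intro a
    simp only [AddMonoidHom.mk'_apply]
    have : (Polynomial.X ^ j * a.map φ : K[X]) = (Polynomial.X ^ j * a).map φ := by simp
    rw [this, ← Polynomial.map_contract hp, Polynomial.map_map, Polynomial.map_map]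
    congr 1
    exact RingHom.ext hcomm
  · intro h
    have := congrArg (fun f => Polynomial.coeff f k) h
    simp only [AddMonoidHom.mk'_apply] at this
    rw [Polynomial.coeff_map, Polynomial.coeff_contract hp, ← hjk, add_comm n j, add_comm j n,
      Polynomial.coeff_X_pow_mul, Polynomial.coeff_zero, map_eq_zero] at this
    exact hn this

theorem IsEigen.exists_of_expand (p : ℕ) [Fact p.Prime] [CharP K p] [PerfectRing K p] {m : ℕ}
    {Z : MvPolynomial σ K[X]} (hZ : IsEigen φ T α (p * m) (expand p Z)) :
    ∃ S : MvPolynomial σ K[X], IsEigen φ T α m S := by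
  classical
  have hp : p ≠ 0 := (Fact.out : p.Prime).ne_zero
  obtain ⟨hZ0, u, hu, h⟩ := hZ
  obtain ⟨W, hW⟩ : ∃ W, W = C (u ^ (p - 1)) * Z := ⟨_, rfl⟩
  have hWne : W ≠ 0 := by
    rw [hW]
    refine mul_ne_zero (by rw [Ne, C_eq_zero]; exact pow_ne_zero _ hu) ?_
    rintro rfl
    exact hZ0 (map_zero _)
  have hW' : C (u ^ p) * twist φ T α (expand p W) = C ((T ^ m * u.map φ) ^ p) * expand p W := by
    have hpp : ∀ a : K[X], a ^ p = a * a ^ (p - 1) := fun a => by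
      rw [← pow_succ', Nat.sub_add_cancel (Nat.pos_of_ne_zero hp)]
    rw [hW, map_mul, expand_C, map_mul, twist_C, Polynomial.map_pow, mul_pow, hpp u, hpp (u.map φ),
      ← pow_mul, mul_comm m p]
    calc _ = C (u ^ (p - 1) * u.map φ ^ (p - 1)) * (C u * twist φ T α (expand p Z)) := by
          simp only [C_mul]; ring
      _ = _ := by rw [h]; simp only [C_mul]; ring
  obtain ⟨ν₀, hν₀⟩ := support_nonempty.2 hWne
  obtain ⟨κ, hκ, hκφ, hκs⟩ := exists_cartier φ p (mem_support_iff.1 hν₀)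
  obtain ⟨S, hS⟩ : ∃ S, S = ∑ μ ∈ W.support, monomial μ (κ (coeff μ W)) := ⟨_, rfl⟩
  have hcS : ∀ ν, coeff ν S = κ (coeff ν W) := by
    intro ν
    rw [hS, coeff_sum]
    simp only [coeff_monomial, Finset.sum_ite_eq']
    split_ifs with h
    · rfl
    · rw [notMem_support_iff.1 h, map_zero]
  have htS : twist φ T α S =
      ∑ μ ∈ W.support, C ((κ (coeff μ W)).map φ) * twist φ T α (monomial μ 1) := by
    rw [hS, map_sum]
    refine Finset.sum_congr rfl fun μ _ => ?_
    rw [← twist_C φ T α, ← map_mul, C_mul_monomial, mul_one]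
  have htW : twist φ T α (expand p W) =
      ∑ μ ∈ W.support, C ((coeff μ W).map φ) * twist φ T α (monomial μ 1) ^ p := by
    conv_lhs => rw [W.as_sum]
    rw [map_sum, map_sum]
    refine Finset.sum_congr rfl fun μ _ => ?_
    rw [expand_monomial, ← twist_C φ T α, ← map_pow, ← map_mul, monomial_pow, C_mul_monomial,
      one_pow, mul_one]
  refine ⟨S, ?_, u, hu, ?_⟩
  · intro h0
    have := hcS ν₀
    rw [h0, coeff_zero] at this
    exact hκs this.symm
  · ext1 ν
    have h1 := congrArg κ (congrArg (coeff (p • ν)) hW')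
    rw [coeff_C_mul, coeff_C_mul, hκ, hκ, coeff_expand_smul _ hp, htW, coeff_sum, map_sum] at h1
    rw [coeff_C_mul, coeff_C_mul, hcS, ← h1, htS, coeff_sum]
    congr 1
    refine Finset.sum_congr rfl fun μ _ => ?_
    rw [coeff_C_mul, coeff_C_mul, coeff_smul_pow_char, mul_comm _ (_ ^ p), hκ, hκφ, mul_comm]

theorem IsEigen.exists_one (hT : T.natDegree = 1) (p : ℕ) [Fact p.Prime] [CharP K p]
    [PerfectRing K p] {m : ℕ} (hm : m ≠ 0) {S : MvPolynomial σ K[X]} (hS : IsEigen φ T α m S) :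
    ∃ S : MvPolynomial σ K[X], IsEigen φ T α 1 S := by
  induction m using Nat.strong_induction_on generalizing S with
  | _ m ih =>
    obtain ⟨m, rfl⟩ := Nat.exists_eq_succ_of_ne_zero hm
    rcases Nat.eq_zero_or_pos m with rfl | hm'
    · exact ⟨S, hS⟩
    have hp := (Fact.out : p.Prime)
    by_cases hd : ∀ i, MvPolynomial.pderiv i S = 0
    · obtain ⟨Z, rfl⟩ := exists_expand_of_pderiv_eq_zero p hd
      have h1 := hS.totalDegree_eq hT
      rw [totalDegree_expand, mul_comm] at h1
      rw [Nat.succ_eq_add_one] at *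
      rw [← h1] at hS
      obtain ⟨S', hS'⟩ := hS.exists_of_expand p
      have hne : Z.totalDegree ≠ 0 := by
        intro h0
        rw [h0] at h1
        omega
      refine ih _ ?_ hne hS'
      rw [← h1]
      exact lt_mul_of_one_lt_left (Nat.pos_of_ne_zero hne) hp.one_lt
    · push Not at hd
      obtain ⟨i, hi⟩ := hd
      exact ih m (Nat.lt_succ_self m) hm'.ne' (hS.pderiv (by rintro rfl; simp at hT) hi)

end Twist

end CarlitzLog

namespace CarlitzLog

open scoped Polynomial
open MvPolynomial

section Relation

variable {K σ : Type*} [Field K] {φ : K →+* K} {T : K[X]} {α : σ → K[X]}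
  {B : Type*} [CommRing B] {τ : B →+* B} {ι : K[X] →+* B} {L : σ → B}

theorem eval_twist (hι : ∀ a, τ (ι a) = ι (a.map φ)) (hL : ∀ i, τ (L i) = ι T * (L i - ι (α i)))
    (S : MvPolynomial σ K[X]) :
    eval₂Hom ι L (twist φ T α S) = τ (eval₂Hom ι L S) := by
  have : (eval₂Hom ι L).comp (twist φ T α) = τ.comp (eval₂Hom ι L) := by
    refine MvPolynomial.ringHom_ext (fun a => ?_) fun i => ?_
    · simp [hι]
    · simp [hL]
  exact RingHom.congr_fun this S

/-- A minimal algebraic relation is an eigenvector of the twist. -/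
theorem exists_isEigen_of_eval_eq_zero (hι : ∀ a, τ (ι a) = ι (a.map φ))
    (hL : ∀ i, τ (L i) = ι T * (L i - ι (α i))) {R : MvPolynomial σ K[X]} (hR : R ≠ 0)
    (hRL : eval₂Hom ι L R = 0) :
    ∃ m, ∃ S : MvPolynomial σ K[X], IsEigen φ T α m S ∧ eval₂Hom ι L S = 0 := by
  classical
  let top : MvPolynomial σ K[X] → Finset (σ →₀ ℕ) := fun S =>
    {ν ∈ S.support | ν.degree = S.totalDegree}
  obtain ⟨S, ⟨hS0, hSL⟩, hmin⟩ := (InvImage.wf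
    (fun S : MvPolynomial σ K[X] => toLex (S.totalDegree, (top S).card))
    (wellFounded_lt (α := ℕ ×ₗ ℕ))).has_min
    {S | S ≠ 0 ∧ eval₂Hom ι L S = 0} ⟨R, hR, hRL⟩
  obtain ⟨ν, hν, hνd⟩ := Finset.exists_mem_eq_sup S.support (support_nonempty.2 hS0)
    fun s => s.degree
  have hνd : S.totalDegree = ν.degree := hνd
  set d := S.totalDegree with hd
  set u := coeff ν S with hu
  set D := C u * twist φ T α S - C (T ^ d * u.map φ) * S with hD
  have hcoeff : ∀ μ : σ →₀ ℕ, d ≤ μ.degree →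
      coeff μ D = u * (T ^ μ.degree * (coeff μ S).map φ) - T ^ d * u.map φ * coeff μ S := by
    intro μ hμ
    rw [hD, coeff_sub, coeff_C_mul, coeff_C_mul, coeff_twist φ T α S hμ]
  have hDd : D.totalDegree ≤ d := by
    refine Finset.sup_le fun μ hμ => ?_
    by_contra! hlt
    have hlt : d < μ.degree := hlt
    rw [mem_support_iff, hcoeff μ hlt.le, coeff_eq_zero_of_totalDegree_lt_degree hlt] at hμ
    simp at hμ
  have hDL : eval₂Hom ι L D = 0 := by
    rw [hD, map_sub, map_mul, map_mul, eval_twist hι hL, hSL]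
    simp
  refine ⟨d, S, ⟨hS0, u, mem_support_iff.1 hν, ?_⟩, hSL⟩
  rw [← sub_eq_zero, ← hD]
  by_contra hD0
  refine hmin D ⟨hD0, hDL⟩ ?_
  change toLex (D.totalDegree, (top D).card) < toLex (S.totalDegree, (top S).card)
  rw [Prod.Lex.toLex_lt_toLex]
  rcases hDd.lt_or_eq with h | h
  · exact Or.inl h
  · refine Or.inr ⟨h, Finset.card_lt_card (Finset.ssubset_iff_of_subset ?_ |>.2 ⟨ν, ?_, ?_⟩)⟩
    · intro μ hμ
      simp only [top, Finset.mem_filter, mem_support_iff] at hμ ⊢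
      rw [h] at hμ
      refine ⟨fun h0 => hμ.1 ?_, hμ.2⟩
      rw [hcoeff μ hμ.2.ge, h0]
      simp
    · simp only [top, Finset.mem_filter]
      exact ⟨hν, hνd.symm⟩
    · simp only [top, Finset.mem_filter, mem_support_iff]
      intro hc
      refine hc.1 ?_
      rw [hcoeff ν hνd.le, ← hu, ← hνd]
      ring

theorem finSuccEquiv_twist {n : ℕ} {α : Fin n → K[X]} (S : MvPolynomial (Fin (n + 1)) K[X])
    (j : ℕ) : (finSuccEquiv K[X] n (twist φ T (Fin.cons 0 α) S)).coeff j =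
      C (T ^ j) * twist φ T α ((finSuccEquiv K[X] n S).coeff j) := by
  have key : ((finSuccEquiv K[X] n : MvPolynomial (Fin (n + 1)) K[X] →+* _).comp
      (twist φ T (Fin.cons 0 α))) = (Polynomial.eval₂RingHom (Polynomial.C.comp (twist φ T α))
        (Polynomial.C (C T) * Polynomial.X)).comp
        (finSuccEquiv K[X] n : MvPolynomial (Fin (n + 1)) K[X] →+* _) := by
    refine MvPolynomial.ringHom_ext (fun a => ?_) fun i => ?_
    · simp [finSuccEquiv_apply]
    · refine Fin.cases ?_ (fun i => ?_) i
      · simp [finSuccEquiv_apply]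
      · simp only [RingHom.comp_apply, twist_X, Fin.cons_succ, map_mul, map_sub]
        simp [finSuccEquiv_apply]
  have h1 := RingHom.congr_fun key S
  simp only [RingHom.comp_apply] at h1
  have h2 : finSuccEquiv K[X] n (twist φ T (Fin.cons 0 α) S) = Polynomial.eval₂
      (Polynomial.C.comp (twist φ T α)) (Polynomial.C (C T) * Polynomial.X)
      (finSuccEquiv K[X] n S) := h1
  rw [h2, Polynomial.eval₂_eq_sum_range, Polynomial.finsetSum_coeff]
  simp only [mul_pow, ← Polynomial.C_pow, RingHom.comp_apply, ← mul_assoc, ← Polynomial.C_mul,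
    Polynomial.coeff_C_mul_X_pow]
  rw [Finset.sum_ite_eq]
  split_ifs with h
  · rw [mul_comm, ← C_pow]
  · rw [Polynomial.coeff_eq_zero_of_natDegree_lt (by simpa using h), map_zero, mul_zero]

theorem exists_isEigen_fin [IsDomain B] (hι : ∀ a, τ (ι a) = ι (a.map φ))
    (hι_inj : Function.Injective ι) (hT : T.natDegree = 1) {n : ℕ} {α : Fin n → K[X]} {L : Fin (n + 1) → B}
    (hL0 : L 0 ≠ 0) (hτ0 : τ (L 0) = ι T * L 0)
    (hL : ∀ i : Fin n, τ (L i.succ) = ι T * (L i.succ - ι (α i)))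
    {R : MvPolynomial (Fin (n + 1)) K[X]} (hR : R ≠ 0) (hRL : eval₂Hom ι L R = 0) :
    ∃ m ≠ 0, ∃ S : MvPolynomial (Fin n) K[X], IsEigen φ T α m S := by
  have hL' : ∀ i, τ (L i) = ι T * (L i - ι ((Fin.cons 0 α : Fin (n + 1) → K[X]) i)) := by
    intro i
    refine Fin.cases ?_ (fun i => ?_) i
    · simp [hτ0]
    · simp [hL]
  obtain ⟨m, S, hS, hSL⟩ := exists_isEigen_of_eval_eq_zero hι hL' hR hRL
  have hT0 : T ≠ 0 := by rintro rfl; simp at hT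
  have hdeg := hS.totalDegree_eq hT
  obtain ⟨hS0, u, hu, hu'⟩ := hS
  have hcoef : ∀ j, C u * (C (T ^ j) * twist φ T α ((finSuccEquiv K[X] n S).coeff j)) =
      C (T ^ m * u.map φ) * (finSuccEquiv K[X] n S).coeff j := by
    intro j
    have h1 := congrArg (fun f => (finSuccEquiv K[X] n f).coeff j) hu'
    simp only [map_mul, finSuccEquiv_apply, eval₂Hom_C, RingHom.comp_apply] at h1
    simp only [← finSuccEquiv_apply, ← map_mul, Polynomial.coeff_C_mul, finSuccEquiv_twist] at h1
    exact h1
  by_cases hj : ∃ j < m, (finSuccEquiv K[X] n S).coeff j ≠ 0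
  · obtain ⟨j, hjm, hj⟩ := hj
    refine ⟨m - j, by omega, _, hj, u, hu, ?_⟩
    have hCT : (C (T ^ j) : MvPolynomial (Fin n) K[X]) ≠ 0 := by
      rw [Ne, C_eq_zero]; exact pow_ne_zero _ hT0
    refine mul_left_cancel₀ hCT ?_
    have hTm : T ^ m = T ^ j * T ^ (m - j) := by rw [← pow_add]; congr 1; omega
    rw [mul_left_comm, hcoef, hTm, ← mul_assoc, ← C_mul]
    congr 2
    ring
  · push Not at hj
    have hj' : ∀ j, j ≠ m → (finSuccEquiv K[X] n S).coeff j = 0 := by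
      intro j hjm
      rcases Nat.lt_or_gt_of_ne hjm with h | h
      · exact hj j h
      · by_contra h0
        have := totalDegree_coeff_finSuccEquiv_add_le S j h0
        omega
    have hP : finSuccEquiv K[X] n S =
        Polynomial.C ((finSuccEquiv K[X] n S).coeff m) * Polynomial.X ^ m := by
      ext1 j
      rw [Polynomial.coeff_C_mul_X_pow]
      split_ifs with h
      · rw [h]
      · exact hj' j h
    have hm0 : (finSuccEquiv K[X] n S).coeff m ≠ 0 := by
      intro h0
      rw [h0, map_zero, zero_mul] at hP
      exact hS0 ((finSuccEquiv K[X] n).injective (by rw [hP, map_zero]))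
    have htd := totalDegree_coeff_finSuccEquiv_add_le S m hm0
    have hc := totalDegree_eq_zero_iff_eq_C.1
      (show ((finSuccEquiv K[X] n S).coeff m).totalDegree = 0 by omega)
    set a := coeff 0 ((finSuccEquiv K[X] n S).coeff m) with ha
    have hSa : S = C a * X 0 ^ m := by
      refine (finSuccEquiv K[X] n).injective ?_
      rw [hP, hc]
      simp [finSuccEquiv_apply]
    have ha0 : a ≠ 0 := by
      intro h0
      rw [h0, map_zero] at hc
      exact hm0 hc
    rw [hSa] at hSL
    simp only [map_mul, map_pow, eval₂Hom_C, eval₂Hom_X'] at hSL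
    rcases mul_eq_zero.1 hSL with h | h
    · exact absurd (hι_inj (by rw [h, map_zero])) ha0
    · exact absurd (eq_zero_of_pow_eq_zero h) hL0

/-- Descent of fractions that are compatible with a coefficientwise field automorphism. -/
theorem exists_descent {J : Type*} {u : K[X]} (hu : u ≠ 0) {s r : J → K[X]}
    (hr : ∀ j, r j ∈ Ideal.span (Set.range s)) (h : ∀ j, u * (s j).map φ = u.map φ * r j) :
    ∃ (w : K[X]) (s' : J → K[X]), w ≠ 0 ∧ (∀ j, s j = w * s' j) ∧
      ∀ j, w * (s' j).map φ = r j := by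
  set I : Ideal K[X] := Ideal.span (insert u (Set.range s)) with hI
  have huI : u ∈ I := Ideal.subset_span (Set.mem_insert _ _)
  have hsI : ∀ j, s j ∈ I := fun j => Ideal.subset_span (Set.mem_insert_of_mem _ ⟨j, rfl⟩)
  have hrI : ∀ j, r j ∈ I := fun j => Ideal.span_mono (Set.subset_insert _ _) (hr j)
  obtain ⟨w, u', hwI, hw, huw, hmon⟩ : ∃ w u' : K[X], w ∈ I ∧ (∀ x ∈ I, w ∣ x) ∧ u = w * u' ∧
      u'.Monic := by
    obtain ⟨g, hg⟩ := (IsPrincipalIdealRing.principal I).principal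
    have hgI : ∀ x, x ∈ I ↔ g ∣ x := fun x => by
      rw [hg, ← Ideal.mem_span_singleton]
    obtain ⟨v, hv⟩ := (hgI u).1 huI
    have hv0 : v ≠ 0 := by rintro rfl; exact hu (by rw [hv, mul_zero])
    have hlc : v.leadingCoeff ≠ 0 := Polynomial.leadingCoeff_ne_zero.2 hv0
    have hCC : (Polynomial.C v.leadingCoeff * Polynomial.C v.leadingCoeff⁻¹ : K[X]) = 1 := by
      rw [← Polynomial.C_mul, mul_inv_cancel₀ hlc, Polynomial.C_1]
    refine ⟨g * Polynomial.C v.leadingCoeff, v * Polynomial.C v.leadingCoeff⁻¹,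
      (hgI _).2 (dvd_mul_right _ _), fun x hx => ?_, ?_,
      Polynomial.monic_mul_leadingCoeff_inv hv0⟩
    · obtain ⟨y, rfl⟩ := (hgI x).1 hx
      refine ⟨Polynomial.C v.leadingCoeff⁻¹ * y, ?_⟩
      linear_combination -(g * y) * hCC
    · rw [hv]
      linear_combination -(g * v) * hCC
  have hw0 : w ≠ 0 := by rintro rfl; exact hu (by rw [huw, zero_mul])
  have hwφ : w.map φ ≠ 0 := (Polynomial.map_ne_zero_iff φ.injective).2 hw0
  have hQ : ∀ x ∈ I, u.map φ * w ∣ u * x.map φ := by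
    intro x hx
    induction hx using Submodule.span_induction with
    | mem x hx =>
      rcases hx with rfl | ⟨j, rfl⟩
      · rw [mul_comm x]
        exact mul_dvd_mul_left _ (hw _ huI)
      · rw [h]
        exact mul_dvd_mul_left _ (hw _ (hrI j))
    | zero => simp
    | add x y _ _ hx hy => rw [Polynomial.map_add, mul_add]; exact dvd_add hx hy
    | smul a x _ hx =>
      rw [smul_eq_mul, Polynomial.map_mul, mul_left_comm]
      exact hx.mul_left _
  have hdvd : u'.map φ ∣ u' := by
    have h1 := hQ w hwI
    rw [huw, Polynomial.map_mul] at h1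
    refine (mul_dvd_mul_iff_left (mul_ne_zero hw0 hwφ)).1 ?_
    convert h1 using 1 <;> ring
  have hinv : u'.map φ = u' :=
    (Polynomial.eq_of_monic_of_dvd_of_natDegree_le (hmon.map φ) hmon hdvd
      (by rw [Polynomial.natDegree_map])).symm
  choose s' hs' using fun j => hw _ (hsI j)
  refine ⟨w, s', hw0, hs', fun j => ?_⟩
  have h1 := h j
  rw [huw, Polynomial.map_mul, hinv, hs' j, Polynomial.map_mul] at h1
  refine mul_left_cancel₀ (mul_ne_zero hwφ hmon.ne_zero) ?_
  linear_combination h1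

/-- An eigenvector of weight one yields an invariant affine form. -/
theorem IsEigen.exists_affine [Fintype σ] (hT : T.natDegree = 1) {S : MvPolynomial σ K[X]}
    (hS : IsEigen φ T α 1 S) : ∃ (s : σ → K[X]) (s₀ : K[X]), (∀ i, (s i).map φ = s i) ∧ s ≠ 0 ∧
      s₀.map φ = T * (s₀ + ∑ i, s i * α i) := by
  classical
  have hT0 : T ≠ 0 := by rintro rfl; simp at hT
  have hdeg := hS.totalDegree_eq hT
  obtain ⟨hS0, u, hu, hu'⟩ := hS
  have hS1 : S = C (coeff 0 S) + ∑ i, C (coeff (Finsupp.single i 1) S) * X i := by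
    ext1 ν
    have hX : ∀ i, coeff ν (X i : MvPolynomial σ K[X]) =
        if Finsupp.single i 1 = ν then 1 else 0 := fun i => coeff_X i ν
    rw [coeff_add, coeff_C, coeff_sum]
    simp only [coeff_C_mul, hX]
    rcases Nat.lt_or_ge 1 ν.degree with h | h
    · rw [coeff_eq_zero_of_totalDegree_lt_degree (by rwa [hdeg]), if_neg,
        Finset.sum_eq_zero, add_zero]
      · intro i _
        rw [if_neg, mul_zero]
        rintro rfl
        rw [Finsupp.degree_single] at h
        exact h.false
      · rintro rfl
        simp at h
    · rcases Nat.le_one_iff_eq_zero_or_eq_one.1 h with h | h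
      · rw [Finsupp.degree_eq_zero_iff] at h
        subst h
        simp
      · obtain ⟨i, rfl⟩ := (Finsupp.sum_eq_one_iff ν).1 h
        rw [if_neg (by intro h0; rw [← h0] at h; simp at h), zero_add,
          Finset.sum_eq_single i]
        · simp
        · intro j _ hj
          rw [if_neg, mul_zero]
          intro h1
          exact hj (Finsupp.single_left_injective one_ne_zero h1)
        · simp
  obtain ⟨s₀, hs₀⟩ : ∃ s₀, s₀ = coeff 0 S := ⟨_, rfl⟩
  obtain ⟨s, hs⟩ : ∃ s : σ → K[X], s = fun i => coeff (Finsupp.single i 1) S := ⟨_, rfl⟩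
  have hlin : ∀ i, u * (s i).map φ = u.map φ * s i := by
    intro i
    have h1 := congrArg (coeff (Finsupp.single i 1)) hu'
    rw [coeff_C_mul, coeff_C_mul, coeff_twist _ _ _ _ (by rw [hdeg, Finsupp.degree_single]),
      Finsupp.degree_single, pow_one] at h1
    refine mul_left_cancel₀ hT0 ?_
    rw [hs]
    linear_combination h1
  have hconst : u * s₀.map φ = u.map φ * (T * (s₀ + ∑ i, s i * α i)) := by
    have h1 := congrArg constantCoeff hu'
    have h2 : constantCoeff (twist φ T α S) = s₀.map φ - T * ∑ i, (s i).map φ * α i := by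
      rw [hS1, map_add, map_sum]
      simp only [map_mul, twist_C, twist_X, map_add, map_sum, map_sub, constantCoeff_C,
        constantCoeff_X, zero_sub, ← hs₀, hs]
      rw [Finset.mul_sum, sub_eq_add_neg, ← Finset.sum_neg_distrib]
      congr 1
      exact Finset.sum_congr rfl fun i _ => by ring
    have h3 : constantCoeff S = s₀ := by rw [hs₀, constantCoeff_eq]
    rw [map_mul, map_mul, constantCoeff_C, constantCoeff_C, h2, h3, pow_one] at h1
    have h4 : u * ∑ i, (s i).map φ * α i = u.map φ * ∑ i, s i * α i := by
      rw [Finset.mul_sum, Finset.mul_sum]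
      refine Finset.sum_congr rfl fun i _ => ?_
      rw [← mul_assoc, hlin, mul_assoc]
    linear_combination h1 + T * h4
  obtain ⟨w, s', hw, hs', hws⟩ := exists_descent (J := Option σ) hu
    (s := fun o => o.elim s₀ s) (r := fun o => o.elim (T * (s₀ + ∑ i, s i * α i)) s) (by
      rintro (_ | i)
      · refine Ideal.mul_mem_left _ _ (add_mem (Ideal.subset_span ⟨none, rfl⟩)
          (sum_mem fun i _ => Ideal.mul_mem_right _ _ (Ideal.subset_span ⟨some i, rfl⟩)))
      · exact Ideal.subset_span ⟨some i, rfl⟩) (by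
      rintro (_ | i)
      · exact hconst
      · exact hlin i)
  have hs0' : s₀ = w * s' none := hs' none
  have hsi' : ∀ i, s i = w * s' (some i) := fun i => hs' (some i)
  refine ⟨fun i => s' (some i), s' none, fun i => ?_, fun h0 => ?_, ?_⟩
  · refine mul_left_cancel₀ hw ?_
    rw [← hsi']
    exact hws (some i)
  · have hs0 : ∀ i, coeff (Finsupp.single i 1) S = 0 := fun i => by
      have := hsi' i
      rwa [congrFun h0 i, Pi.zero_apply, mul_zero, hs] at this
    simp only [hs0, map_zero, zero_mul, Finset.sum_const_zero, add_zero] at hS1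
    rw [hS1, totalDegree_C] at hdeg
    exact zero_ne_one hdeg
  · refine mul_left_cancel₀ hw ((hws none).trans ?_)
    change T * (s₀ + ∑ i, s i * α i) = _
    rw [hs0', mul_left_comm w, mul_add w, Finset.mul_sum]
    congr 2
    exact Finset.sum_congr rfl fun i _ => by rw [hsi', mul_assoc]

end Relation

end CarlitzLog

namespace CarlitzLog

namespace CarlitzData

open Polynomial

section Logarithms

variable {K : Type*} [NormedField K] [IsUltrametricDist K] [CompleteSpace K] (F : CarlitzData K)

omit [IsUltrametricDist K] [CompleteSpace K] in
theorem isAlgebraic_θ : IsAlgebraic F.k F.θ :=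
  isAlgebraic_algebraMap (⟨F.θ, Subfield.subset_closure (Or.inl rfl)⟩ : F.k)

/-- An algebraic relation over algebraic constants lifts to a functional relation. -/
theorem exists_functional_relation {σ : Type*} [Fintype σ] {L : σ → PowerSeries K}
    (hLt : ∀ i, L i ∈ tate K F.R) {a : σ → K} (ha : ∀ i, IsAlgebraic F.k (a i))
    (hL : ∀ i, F.τ (L i) = (F.T : PowerSeries K) * (L i - PowerSeries.C (a i)))
    {E : Subfield K} (hE : ∀ x ∈ E, IsAlgebraic F.k x) {P : MvPolynomial σ E} (hP : P ≠ 0)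
    (hPL : MvPolynomial.aeval (fun i => ev F.θ (L i)) P = 0) :
    ∃ R : MvPolynomial σ K[X], R ≠ 0 ∧
      MvPolynomial.eval₂Hom coeToPowerSeries.ringHom L R = 0 := by
  classical
  set d := P.totalDegree with hd
  let e : (σ → Fin (d + 1)) → (σ →₀ ℕ) := fun μ =>
    Finsupp.equivFunOnFinite.symm fun i => (μ i : ℕ)
  have he : ∀ μ i, e μ i = μ i := fun μ i => rfl
  have he_inj : Function.Injective e := by
    intro μ κ h
    funext i
    exact Fin.ext (by rw [← he, ← he, h])
  have he_surj : ∀ ν ∈ P.support, ν ∈ Finset.univ.image e := by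
    intro ν hν
    have h1 : ∀ i, ν i < d + 1 := fun i =>
      Nat.lt_succ_of_le ((Finsupp.le_degree i ν).trans (MvPolynomial.le_totalDegree hν))
    exact Finset.mem_image.2 ⟨fun i => ⟨ν i, h1 i⟩, Finset.mem_univ _, Finsupp.ext fun i => rfl⟩
  let ψ : (σ → Fin (d + 1)) → PowerSeries K := fun μ => ∏ i, L i ^ (μ i : ℕ)
  have hψt : ∀ μ, ψ μ ∈ tate K F.R := fun μ =>
    prod_mem fun i _ => pow_mem (hLt i) _
  let Φ : (σ → Fin (d + 1)) → (σ → Fin (d + 1)) → K[X] := fun μ κ =>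
    ∏ i, (F.T ^ (μ i : ℕ) * ((-C (a i)) ^ ((μ i : ℕ) - (κ i : ℕ)) *
      ((μ i : ℕ).choose (κ i) : K[X])))
  have hψ : ∀ μ, F.τ (ψ μ) = ∑ κ, ((Φ μ κ : K[X]) : PowerSeries K) * ψ κ := by
    intro μ
    have h1 : ∀ i, F.τ (L i ^ (μ i : ℕ)) = ∑ k : Fin (d + 1),
        ((F.T ^ (μ i : ℕ) * ((-C (a i)) ^ ((μ i : ℕ) - (k : ℕ)) * ((μ i : ℕ).choose k : K[X])) :
          K[X]) : PowerSeries K) * L i ^ (k : ℕ) := by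
      intro i
      rw [map_pow, hL, mul_pow, sub_eq_add_neg, add_pow, Finset.mul_sum,
        Fin.sum_univ_eq_sum_range (fun k => ((F.T ^ (μ i : ℕ) * ((-C (a i)) ^ ((μ i : ℕ) - k) *
          ((μ i : ℕ).choose k : K[X])) : K[X]) : PowerSeries K) * L i ^ k)]
      refine Finset.sum_subset_zero_on_sdiff (Finset.range_mono (μ i).2) ?_ ?_
      · intro k hk
        rw [Finset.mem_sdiff, Finset.mem_range, Finset.mem_range] at hk
        rw [Nat.choose_eq_zero_of_lt (by omega)]
        simp
      · intro k _
        have hn : (((μ i : ℕ).choose k : K[X]) : PowerSeries K) = ((μ i : ℕ).choose k : ℕ) :=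
          map_natCast coeToPowerSeries.ringHom _
        have hneg : ((-C (a i) : K[X]) : PowerSeries K) = -PowerSeries.C (a i) := by
          rw [coe_neg, coe_C]
        rw [coe_mul, coe_mul, coe_pow, coe_pow, hn, hneg]
        ring
    simp only [ψ, Φ]
    rw [map_prod, Finset.prod_congr rfl fun i _ => h1 i, Finset.prod_univ_sum,
      Fintype.piFinset_univ]
    refine Finset.sum_congr rfl fun κ _ => ?_
    rw [Finset.prod_mul_distrib]
    congr 1
    exact (map_prod coeToPowerSeries.ringHom _ _).symm
  have hΦ : ∀ μ κ n, IsAlgebraic F.k ((Φ μ κ).coeff n) := by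
    intro μ κ n
    have hmem : ∀ {x : K}, IsAlgebraic F.k x →
        x ∈ Set.range (algebraMap (algebraicClosure F.k K) K) := fun {x} hx =>
      ⟨⟨x, mem_algebraicClosure_iff.2 hx⟩, rfl⟩
    have h1 : Φ μ κ ∈ lifts (algebraMap (algebraicClosure F.k K) K) := by
      refine prod_mem fun i _ => mul_mem (pow_mem ?_ _) (mul_mem (pow_mem ?_ _) (natCast_mem _ _))
      · rw [T, sub_eq_add_neg, ← C_neg]
        exact add_mem (X_mem_lifts _) (C'_mem_lifts (hmem (F.isAlgebraic_θ.pow _).neg))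
      · rw [← C_neg]
        exact C'_mem_lifts (hmem (ha i).neg)
    obtain ⟨y, hy⟩ := (lifts_iff_coeff_lifts _).1 h1 n
    rw [← hy]
    exact mem_algebraicClosure_iff.1 y.2
  obtain ⟨ν₀, hν₀⟩ := MvPolynomial.support_nonempty.2 hP
  have hsum : ∑ μ, ((MvPolynomial.coeff (e μ) P : E) : K) * ev F.θ (ψ μ) = 0 := by
    rw [← hPL, MvPolynomial.aeval_def, MvPolynomial.eval₂_eq']
    rw [Finset.sum_subset (s₂ := Finset.univ.image e) he_surj, Finset.sum_image he_inj.injOn]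
    · refine Finset.sum_congr rfl fun μ _ => ?_
      congr 1
      exact ev_prod_pow _ _ (fun i _ => hLt i) F.norm_θ_lt_R
    · intro ν _ hν
      rw [MvPolynomial.notMem_support_iff.1 hν, map_zero, zero_mul]
  obtain ⟨h, hh, hform⟩ := F.exists_relation hψt hψ hΦ
    (ρ := fun μ => ((MvPolynomial.coeff (e μ) P : E) : K)) (fun μ => hE _ (Subtype.mem _))
    (fun h0 => by
      obtain ⟨μ, -, rfl⟩ := Finset.mem_image.1 (he_surj _ hν₀)
      exact MvPolynomial.mem_support_iff.1 hν₀ (Subtype.ext (congrFun h0 μ))) hsum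
  refine ⟨∑ μ, MvPolynomial.monomial (e μ) (h μ), fun h0 => hh (funext fun μ => ?_), ?_⟩
  · have h1 := congrArg (MvPolynomial.coeff (e μ)) h0
    rw [MvPolynomial.coeff_sum, Finset.sum_eq_single μ] at h1
    · simpa using h1
    · intro κ _ hκ
      rw [MvPolynomial.coeff_monomial, if_neg fun h => hκ (he_inj h)]
    · simp
  · rw [map_sum, ← hform, form]
    refine Finset.sum_congr rfl fun μ _ => ?_
    rw [MvPolynomial.eval₂Hom_monomial, coeToPowerSeries.ringHom_apply,
      Finsupp.prod_fintype _ _ fun i => pow_zero _]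
    rfl

omit [IsUltrametricDist K] [CompleteSpace K] in
theorem θ_mem_k : F.θ ∈ F.k := Subfield.subset_closure (Or.inl rfl)

omit [IsUltrametricDist K] [CompleteSpace K] in
theorem eval_mem_k {c : K[X]} (hc : ∀ n, c.coeff n ∈ F.Fq) : c.eval F.θ ∈ F.k := by
  rw [eval_eq_sum_range]
  refine sum_mem fun n _ => mul_mem ?_ (pow_mem F.θ_mem_k _)
  have h := F.mem_Fq.1 (hc n)
  rw [F.φ_apply] at h
  exact Subfield.subset_closure (Set.mem_union_right _ h)

omit [CompleteSpace K] in
theorem eval_θ_ne_zero {c : K[X]} (hc : ∀ n, c.coeff n ∈ F.Fq) (h0 : c ≠ 0) :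
    c.eval F.θ ≠ 0 := by
  obtain ⟨g, rfl⟩ := (mem_lifts c).1 ((lifts_iff_coeff_lifts (f := algebraMap F.Fq K) c).2
    fun n => ⟨⟨_, hc n⟩, rfl⟩)
  intro h
  refine h0 ?_
  rw [eval_map_algebraMap] at h
  rw [F.aeval_injective (by rw [F.norm_θ]; linarith [F.two_le_real])
    (h.trans (map_zero (aeval F.θ)).symm), Polynomial.map_zero]

omit [IsUltrametricDist K] [CompleteSpace K] in
theorem map_φ_eq_iff {c : K[X]} : c.map F.φ = c ↔ ∀ n, c.coeff n ∈ F.Fq := by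
  simp [Polynomial.ext_iff, F.mem_Fq]

/-- If `ev θ ∘ L` is linearly independent over `F.k` modulo `ev θ L₀`, then the logarithm series
`L` and the period series `L₀` are algebraically independent over `K[t]`. -/
theorem functional_independence [IsAlgClosed K] (p : ℕ) [Fact p.Prime] [CharP K p]
    {L₀ : PowerSeries K} (hL₀t : L₀ ∈ tate K F.R) (hL₀ : L₀ ≠ 0)
    (hL₀τ : F.τ L₀ = (F.T : PowerSeries K) * L₀)
    (hL₀f : ∀ f ∈ tate K F.R, F.τ f = (F.T : PowerSeries K) * f →
      ∃ c : K[X], (∀ n, c.coeff n ∈ F.Fq) ∧ f = (c : PowerSeries K) * L₀)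
    {n : ℕ} {L : Fin n → PowerSeries K} (hLt : ∀ i, L i ∈ tate K F.R) {a : Fin n → K}
    (hL : ∀ i, F.τ (L i) = (F.T : PowerSeries K) * (L i - PowerSeries.C (a i)))
    (hind : ∀ s : Fin n → K, (∀ i, s i ∈ F.k) → ∀ c ∈ F.k,
      ∑ i, s i * ev F.θ (L i) = c * ev F.θ L₀ → s = 0)
    {R : MvPolynomial (Fin (n + 1)) K[X]}
    (hR : MvPolynomial.eval₂Hom coeToPowerSeries.ringHom
      (Fin.cons L₀ L : Fin (n + 1) → PowerSeries K) R = 0) : R = 0 := by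
  by_contra hR0
  have : PerfectRing K p := PerfectField.toPerfectRing p
  have hT : F.T.natDegree = 1 := natDegree_X_sub_C _
  obtain ⟨m, hm, S, hS⟩ := exists_isEigen_fin (φ := F.φ) (τ := F.τ) (T := F.T)
    (ι := coeToPowerSeries.ringHom) (α := fun i => C (a i))
    (L := (Fin.cons L₀ L : Fin (n + 1) → PowerSeries K))
    (fun f => F.τ_coe f) (coe_injective K) hT hL₀ hL₀τ
    (fun i => by
      rw [Fin.cons_succ, hL i, coeToPowerSeries.ringHom_apply, coeToPowerSeries.ringHom_apply,
        coe_C]) hR0 hR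
  obtain ⟨S, hS⟩ := IsEigen.exists_one hT p hm hS
  obtain ⟨s, s₀, hs, hs0, hs₀⟩ := IsEigen.exists_affine hT hS
  have hsFq := fun i => F.map_φ_eq_iff.1 (hs i)
  have hev0 : ev F.θ (s₀ : PowerSeries K) = 0 := by
    rw [← map_eq_zero F.φ, F.φ_ev (polynomial_mem_tate _ _) F.norm_θ_lt_R, F.τ_coe, hs₀,
      ev_polynomial, F.φ_apply, T, eval_mul, eval_sub, eval_X, eval_C, sub_self, zero_mul]
  have hst : ∀ i ∈ Finset.univ, (s i : PowerSeries K) * L i ∈ tate K F.R := fun i _ =>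
    mul_mem (polynomial_mem_tate _ _) (hLt i)
  obtain ⟨c, hc, hcf⟩ := hL₀f (∑ i, (s i : PowerSeries K) * L i + (s₀ : PowerSeries K))
    (add_mem (sum_mem hst) (polynomial_mem_tate _ _)) (by
      rw [map_add, map_sum, F.τ_coe, hs₀]
      simp only [map_mul, F.τ_coe, hs, hL]
      have hsum : ((∑ i, s i * C (a i) : K[X]) : PowerSeries K) =
          ∑ i, (s i : PowerSeries K) * PowerSeries.C (a i) := by
        rw [← coeToPowerSeries.ringHom_apply, map_sum]
        refine Finset.sum_congr rfl fun i _ => ?_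
        rw [coeToPowerSeries.ringHom_apply, coe_mul, coe_C]
      rw [coe_mul, coe_add, hsum]
      simp only [mul_add, Finset.mul_sum, mul_sub, Finset.sum_sub_distrib]
      simp only [mul_left_comm]
      ring)
  have hrel := congrArg (ev F.θ) hcf
  rw [ev_add (sum_mem hst) (polynomial_mem_tate _ _) F.norm_θ_lt_R, hev0, add_zero,
    ev_sum _ hst F.norm_θ_lt_R, ev_mul (polynomial_mem_tate _ _) hL₀t F.norm_θ_lt_R,
    ev_polynomial] at hrel
  have h0 := hind (fun i => (s i).eval F.θ) (fun i => F.eval_mem_k (hsFq i)) _ (F.eval_mem_k hc)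
    (by
      rw [← hrel]
      refine Finset.sum_congr rfl fun i _ => ?_
      rw [ev_mul (polynomial_mem_tate _ _) (hLt i) F.norm_θ_lt_R, ev_polynomial])
  refine hs0 (funext fun i => ?_)
  by_contra hi
  exact F.eval_θ_ne_zero (hsFq i) hi (congrFun h0 i)

end Logarithms

end CarlitzData

end CarlitzLog

namespace CarlitzLog

theorem injective_of_surjective_ringEnd {R : Type*} [CommRing R] [IsNoetherianRing R]
    (f : R →+* R) (hf : Function.Surjective f) : Function.Injective f := by
  have hmono : Monotone fun n : ℕ => RingHom.ker (f ^ n) := by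
    refine monotone_nat_of_le_succ fun n x hx => ?_
    rw [RingHom.mem_ker] at hx ⊢
    rw [pow_succ', RingHom.mul_def, RingHom.comp_apply, hx, map_zero]
  obtain ⟨n, hn⟩ := monotone_stabilizes_iff_noetherian.2 ‹IsNoetherianRing R› ⟨_, hmono⟩
  rw [injective_iff_map_eq_zero]
  intro x hx
  have hfn : Function.Surjective (f ^ n : R →+* R) := by
    clear hn
    induction n with
    | zero => exact Function.surjective_id
    | succ n ih => rw [pow_succ', RingHom.mul_def]; exact hf.comp ih
  obtain ⟨y, rfl⟩ := hfn x
  have h1 : y ∈ RingHom.ker (f ^ (n + 1)) := by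
    rw [RingHom.mem_ker, pow_succ', RingHom.mul_def, RingHom.comp_apply, hx]
  have h2 := hn (n + 1) (Nat.le_succ n)
  change RingHom.ker (f ^ n) = RingHom.ker (f ^ (n + 1)) at h2
  rw [← h2] at h1
  exact h1

theorem algebraicIndependent_of_mem_adjoin {σ E A : Type*} [Finite σ] [Field E] [CommRing A]
    [Algebra E A] {x y : σ → A} (hx : AlgebraicIndependent E x)
    (hxy : ∀ i, x i ∈ Algebra.adjoin E (Set.range y))
    (hyx : ∀ i, y i ∈ Algebra.adjoin E (Set.range x)) : AlgebraicIndependent E y := by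
  simp only [Algebra.adjoin_range_eq_range_aeval, AlgHom.mem_range] at hxy hyx
  choose f hf using hxy
  choose g hg using hyx
  have hcomp : (MvPolynomial.aeval x).comp (MvPolynomial.aeval g) =
      (MvPolynomial.aeval y : MvPolynomial σ E →ₐ[E] A) := by
    ext i
    simp [hg]
  have hsurj : Function.Surjective (MvPolynomial.aeval g : MvPolynomial σ E →ₐ[E] _) := by
    rw [← AlgHom.range_eq_top, eq_top_iff, ← MvPolynomial.adjoin_range_X, Algebra.adjoin_le_iff]
    rintro _ ⟨i, rfl⟩
    refine ⟨f i, hx ?_⟩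
    change ((MvPolynomial.aeval x).comp (MvPolynomial.aeval g)) (f i) = _
    rw [hcomp, hf, MvPolynomial.aeval_X]
  rw [AlgebraicIndependent, ← hcomp, AlgHom.coe_comp]
  exact Function.Injective.comp hx (injective_of_surjective_ringEnd _ hsurj)

namespace CarlitzData

section Independence

variable {K : Type*} [NormedField K] [IsUltrametricDist K] [CompleteSpace K] [IsAlgClosed K]
  (F : CarlitzData K) (p : ℕ) [Fact p.Prime] [CharP K p]

include p in
/-- Logarithm series whose values are independent over `F.k` modulo the period are algebraically
independent. -/
theorem algebraicIndependent_ev_cons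
    {L₀ : PowerSeries K} (hL₀t : L₀ ∈ tate K F.R) (hL₀ : L₀ ≠ 0)
    (hL₀τ : F.τ L₀ = (F.T : PowerSeries K) * L₀)
    (hL₀f : ∀ f ∈ tate K F.R, F.τ f = (F.T : PowerSeries K) * f →
      ∃ c : Polynomial K, (∀ n, c.coeff n ∈ F.Fq) ∧ f = (c : PowerSeries K) * L₀)
    {n : ℕ} {L : Fin n → PowerSeries K} (hLt : ∀ i, L i ∈ tate K F.R)
    {a : Fin n → K} (ha : ∀ i, IsAlgebraic F.k (a i))
    (hL : ∀ i, F.τ (L i) = (F.T : PowerSeries K) * (L i - PowerSeries.C (a i)))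
    (hind : ∀ s : Fin n → K, (∀ i, s i ∈ F.k) → ∀ c ∈ F.k,
      ∑ i, s i * ev F.θ (L i) = c * ev F.θ L₀ → s = 0)
    {E : Subfield K} (hE : ∀ x ∈ E, IsAlgebraic F.k x) :
    AlgebraicIndependent E
      (Fin.cons (ev F.θ L₀) (fun i => ev F.θ (L i)) : Fin (n + 1) → K) := by
  have hcons : (Fin.cons (ev F.θ L₀) (fun i => ev F.θ (L i)) : Fin (n + 1) → K) =
      fun i => ev F.θ ((Fin.cons L₀ L : Fin (n + 1) → PowerSeries K) i) := by
    funext i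
    refine Fin.cases ?_ (fun i => ?_) i <;> simp
  rw [hcons, algebraicIndependent_iff]
  intro P hP
  by_contra hP0
  obtain ⟨R, hR0, hR⟩ := F.exists_functional_relation
    (L := (Fin.cons L₀ L : Fin (n + 1) → PowerSeries K))
    (a := (Fin.cons 0 a : Fin (n + 1) → K))
    (Fin.cases hL₀t hLt) (Fin.cases isAlgebraic_zero ha)
    (Fin.cases (by simpa using hL₀τ) (by simpa using hL)) hE hP0 hP
  exact hR0 (F.functional_independence p hL₀t hL₀ hL₀τ hL₀f hLt hL hind hR)

include p in
/-- Carlitz logarithms of algebraic elements that are linearly independent over `F.k` are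
algebraically independent. -/
theorem algebraicIndependent_log {n : ℕ} {l : Fin n → K}
    (hl : ∀ i, IsAlgebraic F.k (F.exp (l i))) (hLI : LinearIndependent F.k l)
    {E : Subfield K} (hkE : F.k ≤ E) (hE : ∀ x ∈ E, IsAlgebraic F.k x) :
    AlgebraicIndependent E l := by
  obtain ⟨L₀, hL₀t, hL₀c, hL₀τ, hL₀f⟩ := F.exists_periodSeries
  have hL₀ : L₀ ≠ 0 := fun h => hL₀c (by rw [h, map_zero])
  choose L hLt hLτ hLl using F.exists_logSeries
  have hli : ∀ s : Fin n → K, (∀ i, s i ∈ F.k) → ∑ i, s i * l i = 0 → s = 0 := by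
    intro s hs h
    funext i
    exact congrArg Subtype.val
      (Fintype.linearIndependent_iff.1 hLI (fun i => (⟨s i, hs i⟩ : F.k)) h i)
  set l₀ := ev F.θ L₀ with hl₀
  have key : ∀ {n : ℕ} (v : Fin n → K), (∀ i, IsAlgebraic F.k (F.exp (v i))) →
      (∀ s : Fin n → K, (∀ i, s i ∈ F.k) → ∀ c ∈ F.k, ∑ i, s i * v i = c * l₀ → s = 0) →
      AlgebraicIndependent E (Fin.cons l₀ v : Fin (n + 1) → K) := by
    intro n v hv hind
    have hvl : (fun i => ev F.θ (L (v i))) = v := funext fun i => hLl _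
    have h := F.algebraicIndependent_ev_cons p hL₀t hL₀ hL₀τ hL₀f (fun i => hLt (v i)) hv
      (fun i => hLτ (v i)) (by simpa only [hLl] using hind) hE
    rwa [hvl] at h
  by_cases hind : ∀ s : Fin n → K, (∀ i, s i ∈ F.k) → ∀ c ∈ F.k, ∑ i, s i * l i = c * l₀ → s = 0
  · have h := (key l hl hind).comp Fin.succ (Fin.succ_injective n)
    rwa [show (Fin.cons l₀ l : Fin (n + 1) → K) ∘ Fin.succ = l from
      funext fun i => Fin.cons_succ _ _ _] at h
  push Not at hind
  obtain ⟨s, hs, c, hc, hsc, hs0⟩ := hind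
  obtain ⟨j, hj⟩ := Function.ne_iff.1 hs0
  rw [Pi.zero_apply] at hj
  have hc0 : c ≠ 0 := by
    rintro rfl
    exact hs0 (hli s hs (by rw [hsc, zero_mul]))
  obtain _ | n := n
  · exact j.elim0
  have hx := key (fun i => l (j.succAbove i)) (fun i => hl _) (by
    intro s' hs' c' hc' h
    have h1 := hli (fun i => c * (j.insertNth 0 s' : Fin (n + 1) → K) i - c' * s i)
      (fun i => sub_mem (mul_mem hc (by
        refine Fin.succAboveCases j ?_ (fun i => ?_) i
        · simp
        · simpa using hs' i)) (mul_mem hc' (hs i))) (by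
        simp only [sub_mul, Finset.sum_sub_distrib, mul_assoc, ← Finset.mul_sum, hsc]
        rw [Fin.sum_univ_succAbove _ j]
        simp only [Fin.insertNth_apply_same, Fin.insertNth_apply_succAbove, h]
        ring)
    have h2 := congrFun h1 j
    have h3 : c' = 0 := by simpa [hj] using h2
    funext i
    have h4 := congrFun h1 (j.succAbove i)
    simpa [h3, hc0] using h4)
  have hkA : ∀ (A : Subalgebra E K) {x : K}, x ∈ F.k → x ∈ A := fun A x hx =>
    A.algebraMap_mem (⟨x, hkE hx⟩ : E)
  refine algebraicIndependent_of_mem_adjoin hx ?_ ?_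
  · refine Fin.cases ?_ fun i => ?_
    · rw [Fin.cons_zero, ← inv_mul_cancel_left₀ hc0 l₀, ← hsc]
      exact mul_mem (hkA _ (inv_mem hc)) (sum_mem fun i _ =>
        mul_mem (hkA _ (hs i)) (Algebra.subset_adjoin (Set.mem_range_self i)))
    · rw [Fin.cons_succ]
      exact Algebra.subset_adjoin (Set.mem_range_self _)
  · have hmem : ∀ i, l (j.succAbove i) ∈ Algebra.adjoin E
        (Set.range (Fin.cons l₀ (fun i => l (j.succAbove i)) : Fin (n + 1) → K)) := fun i =>
      Algebra.subset_adjoin ⟨i.succ, Fin.cons_succ _ _ _⟩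
    refine fun i => Fin.succAboveCases j ?_ hmem i
    rw [Fin.sum_univ_succAbove _ j, ← eq_sub_iff_add_eq] at hsc
    rw [← inv_mul_cancel_left₀ hj (l j), hsc]
    exact mul_mem (hkA _ (inv_mem (hs j))) (sub_mem
      (mul_mem (hkA _ hc) (Algebra.subset_adjoin ⟨0, Fin.cons_zero _ _⟩))
      (sum_mem fun i _ => mul_mem (hkA _ (hs _)) (hmem i)))

end Independence

end CarlitzData

end CarlitzLog

/-- **Paper's main Theorem `AlgIndCarlitzLogs` (Theorem 1.2.5 / 6.4.2).**
Let `λ₁, …, λ_r ∈ 𝕂` satisfy `exp_C(λ_i) ∈ k̄`.  If `λ₁, …, λ_r` are linearly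
independent over `k = 𝔽_q(θ)`, then they are algebraically independent over `k̄`. -/
theorem algebraic_independence_of_carlitz_logarithms
    (p m q : ℕ) [Fact p.Prime] (hm : 0 < m) (hq : q = p ^ m)
    (𝕂 : Type) [NormedField 𝕂] [CompleteSpace 𝕂] [IsAlgClosed 𝕂] [CharP 𝕂 p]
    (hna : IsNonarchimedean (fun x : 𝕂 => ‖x‖))
    (θ : 𝕂) (hθ : ‖θ‖ = q)
    (hdense : Dense {x : 𝕂 | IsAlgebraic ((kk q 𝕂 θ).topologicalClosure) x})
    (r : ℕ) (lam : Fin r → 𝕂)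
    -- each `exp_C(λ_i)` converges to an element of `k̄`
    (hexp : ∀ i, ∃ e : 𝕂, IsAlgebraic (kk q 𝕂 θ) e ∧
      Tendsto (expCPartial q 𝕂 θ (lam i)) atTop (nhds e))
    -- `λ₁, …, λ_r` are linearly independent over `k`
    (hLI : LinearIndependent (kk q 𝕂 θ) lam) :
    -- then they are algebraically independent over `k̄`
    AlgebraicIndependent (kbarSub q 𝕂 θ) lam := by
  have := IsUltrametricDist.isUltrametricDist_of_isNonarchimedean_norm hna
  have hp := (Fact.out : p.Prime)
  have hq2 : 2 ≤ q := by
    rw [hq]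
    exact hp.two_le.trans (Nat.le_self_pow hm.ne' p)
  choose root hroot using fun x : 𝕂 => IsAlgClosed.exists_pow_nat_eq x (n := q) (by omega)
  let F : CarlitzLog.CarlitzData 𝕂 :=
    { q := q
      two_le := hq2
      φ := iterateFrobenius 𝕂 p m
      φ_apply := fun x => by rw [iterateFrobenius_def, hq]
      th := fun n => root^[n] θ
      norm_th_zero := hθ
      th_pow := fun n => by rw [Function.iterate_succ_apply', hroot] }
  have hkk : F.k = kk q 𝕂 θ := rfl
  have hexpF : ∀ i, IsAlgebraic (kk q 𝕂 θ) (F.exp (lam i)) := by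
    intro i
    obtain ⟨e, he, hlim⟩ := hexp i
    rwa [tendsto_nhds_unique (F.hasSum_exp (lam i)).tendsto_sum_nat hlim]
  refine F.algebraicIndependent_log p hexpF hLI ?_ ?_
  · exact fun x hx => Subfield.subset_closure
      (isAlgebraic_algebraMap (⟨x, hx⟩ : kk q 𝕂 θ))
  · intro x hx
    have hle : kbarSub q 𝕂 θ ≤ (algebraicClosure (kk q 𝕂 θ) 𝕂).toSubfield :=
      Subfield.closure_le.2 fun y hy => mem_algebraicClosure_iff.2 hy
    exact mem_algebraicClosure_iff.1 (hle hx)
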